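/- arXiv:2006.15267 — 3 statements merged into one kernel-verified Lean document; each statement's English description precedes it below -/
import Mathlib

section
/- Let (H, β) be a Hom-Hopf algebra. Then H is a right-right Yetter-Drinfel'd module over itself with right action the multiplication m_H and right coaction ρ(h) = β^{-1}(h_{12}) ⊗ Sβ^{-2}(h_{11})β^{-1}(h_2). -/
open TensorProduct

namespace YDGen
section Generic
open Coalgebra WithConv HopfAlgebra

variable {k : Type} [Field k] {H : Type} [Ring H] [HopfAlgebra k H]

lemma conv_antipode_left {B : Type} [Semiring B] [Algebra k B] (f : H →ₐ[k] B) :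
    toConv (f.toLinearMap ∘ₗ antipode k) * toConv f.toLinearMap = 1 := by
  ext c
  rw [(ℛ k c).convMul_apply]
  have := congrArg f (sum_antipode_mul_eq_algebraMap_counit (ℛ k c))
  simpa [map_sum] using this

lemma conv_antipode_right {B : Type} [Semiring B] [Algebra k B] (f : H →ₐ[k] B) :
    toConv f.toLinearMap * toConv (f.toLinearMap ∘ₗ antipode k) = 1 := by
  ext c
  rw [(ℛ k c).convMul_apply]
  have := congrArg f (sum_mul_antipode_eq_algebraMap_counit (ℛ k c))
  simpa [map_sum] using this

abbrev i2 (k : Type) [Field k] (H : Type) [Ring H] [HopfAlgebra k H] : H →ₐ[k] H ⊗[k] H :=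
  Algebra.TensorProduct.includeRight

noncomputable def rho (k : Type) [Field k] (H : Type) [Ring H] [HopfAlgebra k H] :
    H →ₗ[k] H ⊗[k] H :=
  (toConv ((i2 k H).toLinearMap ∘ₗ antipode k) * toConv (comul : H →ₗ[k] H ⊗[k] H)).ofConv

lemma rho_apply {h : H} {ι : Type} (r : Repr k h ι) :
    rho k H h = ∑ i ∈ r.index, (1 ⊗ₜ[k] antipode k (r.left i)) * comul (r.right i) := by
  exact r.convMul_apply _ _

lemma rho_eq (h : H) : rho k H h =
    TensorProduct.map LinearMap.id (LinearMap.mul' k H ∘ₗ TensorProduct.map (antipode k) LinearMap.id)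
      (TensorProduct.leftComm k H H H (TensorProduct.assoc k H H H
        (TensorProduct.map comul LinearMap.id (comul h)))) := by
  have h1 := Coalgebra.coassoc_apply (R := k) h
  rw [LinearMap.rTensor_def] at h1
  rw [h1, rho_apply (ℛ k h)]
  conv_rhs => rw [← (ℛ k h).eq]
  simp only [map_sum, LinearMap.lTensor_tmul]
  refine Finset.sum_congr rfl fun i _ => ?_
  generalize (comul ((ℛ k h).right i) : H ⊗[k] H) = t
  induction t with
  | zero => simp
  | add x y hx hy => simp only [mul_add, tmul_add, map_add, hx, hy]
  | tmul x y => simp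

lemma rho_counit (h : H) :
    TensorProduct.rid k H (TensorProduct.map LinearMap.id counit (rho k H h)) = h := by
  rw [rho_apply (ℛ k h)]
  simp only [map_sum]
  have key : ∀ (a : H) (t : H ⊗[k] H), TensorProduct.rid k H (TensorProduct.map LinearMap.id counit
      ((1 ⊗ₜ[k] a) * t)) = (counit a : k) • TensorProduct.rid k H (counit.lTensor H t) := by
    intro a t
    induction t with
    | zero => simp
    | add x y hx hy => simp only [mul_add, smul_add, map_add, hx, hy]
    | tmul x y => simp [mul_smul]
  simp only [key, Coalgebra.lTensor_counit_comul, counit_antipode]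
  simpa using Coalgebra.sum_counit_smul (ℛ k h)

lemma rho_compat (v h : H) {ι : Type} (r : Repr k h ι) :
    ∑ i ∈ r.index, (1 ⊗ₜ[k] r.left i) * rho k H (v * r.right i) = rho k H v * comul h := by
  have e : toConv (rho k H ∘ₗ LinearMap.mulLeft k v) =
      toConv ((i2 k H).toLinearMap ∘ₗ antipode k) *
        toConv (LinearMap.mulLeft k (rho k H v) ∘ₗ comul) := by
    ext x
    rw [(ℛ k x).convMul_apply]
    let q : Repr k (v * x) ((H × H) × (H × H)) :=
      { index := (ℛ k v).index ×ˢ (ℛ k x).index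
        left := fun p => (ℛ k v).left p.1 * (ℛ k x).left p.2
        right := fun p => (ℛ k v).right p.1 * (ℛ k x).right p.2
        eq := by
          rw [Bialgebra.comul_mul, ← (ℛ k v).eq, ← (ℛ k x).eq, Finset.sum_mul_sum,
            Finset.sum_product]
          simp }
    have := rho_apply q
    simp only [LinearMap.comp_apply, LinearMap.mulLeft_apply]
    rw [this, rho_apply (ℛ k v)]
    simp only [q]
    rw [Finset.sum_product_right]
    refine Finset.sum_congr rfl fun i _ => ?_
    simp [Finset.mul_sum, Finset.sum_mul, antipode_mul_antidistrib, ← mul_assoc]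
  have e2 : toConv (i2 k H).toLinearMap * toConv (rho k H ∘ₗ LinearMap.mulLeft k v) =
      toConv (LinearMap.mulLeft k (rho k H v) ∘ₗ comul) := by
    have e1 := conv_antipode_right (k := k) (i2 k H)
    rw [e, ← mul_assoc]
    exact (congrArg (· * _) e1).trans (one_mul _)
  have e3 := congrArg (fun f : WithConv (H →ₗ[k] H ⊗[k] H) => f h) e2
  simp only [r.convMul_apply] at e3
  simpa using e3

lemma rho_coassoc (h : H) : TensorProduct.map (rho k H) LinearMap.id (rho k H h) =
    (TensorProduct.assoc k H H H).symm (TensorProduct.map LinearMap.id comul (rho k H h)) := by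
  let j2 : H →ₐ[k] (H ⊗[k] H) ⊗[k] H := Algebra.TensorProduct.includeLeft.comp Algebra.TensorProduct.includeRight
  let j3 : H →ₐ[k] (H ⊗[k] H) ⊗[k] H := Algebra.TensorProduct.includeRight
  have hj2 : ∀ x, j2 x = ((1 : H) ⊗ₜ[k] x) ⊗ₜ[k] (1 : H) := fun x => rfl
  have hj3 : ∀ x, j3 x = (1 : H ⊗[k] H) ⊗ₜ[k] x := fun x => rfl
  let g : H ⊗[k] H →ₐ[k] (H ⊗[k] H) ⊗[k] H := (Algebra.TensorProduct.assoc k k k H H H).symm.toAlgHom.comp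
      (Algebra.TensorProduct.map (AlgHom.id k H) (Bialgebra.comulAlgHom k H))
  let f : H →ₐ[k] (H ⊗[k] H) ⊗[k] H := g.comp Algebra.TensorProduct.includeRight
  let D : H →ₗ[k] (H ⊗[k] H) ⊗[k] H := g.toLinearMap ∘ₗ comul
  have hg : ∀ x, g x = (TensorProduct.assoc k H H H).symm (TensorProduct.map LinearMap.id comul x) :=
    fun x => rfl
  have hf : toConv f.toLinearMap = toConv j2.toLinearMap * toConv j3.toLinearMap := by
    ext x
    rw [(ℛ k x).convMul_apply]
    have : f x = (TensorProduct.assoc k H H H).symm (1 ⊗ₜ comul x) := rfl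
    simp only [AlgHom.toLinearMap_apply]
    rw [this, ← (ℛ k x).eq]
    simp [tmul_sum, hj2, hj3, Algebra.TensorProduct.one_def]
  have hS : toConv (f.toLinearMap ∘ₗ antipode k) =
      toConv (j3.toLinearMap ∘ₗ antipode k) * toConv (j2.toLinearMap ∘ₗ antipode k) := by
    have a1 := conv_antipode_left f
    have a2 := conv_antipode_right j2
    have a3 := conv_antipode_right j3
    refine left_inv_eq_right_inv a1 ?_
    rw [hf, mul_assoc, ← mul_assoc (toConv j3.toLinearMap), a3, one_mul, a2]
  have hR : toConv (g.toLinearMap ∘ₗ rho k H) = toConv (f.toLinearMap ∘ₗ antipode k) * toConv D := by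
    ext x
    rw [(ℛ k x).convMul_apply]
    simp only [LinearMap.comp_apply, rho_apply (ℛ k x), map_sum, map_mul,
      AlgHom.toLinearMap_apply]
    rfl
  have hL1 : toConv (TensorProduct.map (rho k H) LinearMap.id ∘ₗ comul) =
      toConv (j2.toLinearMap ∘ₗ antipode k) * toConv D := by
    ext x
    rw [(ℛ k x).convMul_apply]
    have h2 : (TensorProduct.map (rho k H) LinearMap.id) (comul x) =
      TensorProduct.map (LinearMap.mul' k (H ⊗[k] H)) LinearMap.id
        (TensorProduct.map (TensorProduct.map ((i2 k H).toLinearMap ∘ₗ antipode k) comul)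
          LinearMap.id (comul.rTensor H (comul x))) := by
      rw [LinearMap.rTensor_def, ← LinearMap.comp_apply, ← LinearMap.comp_apply, ← TensorProduct.map_comp, ← LinearMap.comp_apply, ← TensorProduct.map_comp]
      rfl
    simp only [LinearMap.comp_apply]
    rw [h2, ← Coalgebra.coassoc_symm_apply]
    conv_lhs => rw [← (ℛ k x).eq]
    simp only [map_sum, LinearMap.lTensor_tmul]
    refine Finset.sum_congr rfl fun i _ => ?_
    have h3 : D ((ℛ k x).right i) = comul.rTensor H (comul ((ℛ k x).right i)) := by
      rw [← Coalgebra.coassoc_symm_apply]; rfl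
    rw [h3]
    generalize (comul ((ℛ k x).right i) : H ⊗[k] H) = t
    induction t with
    | zero => simp
    | add x y hx hy => simp only [mul_add, tmul_add, map_add, hx, hy]
    | tmul x y => simp [hj2]
  have hL : toConv (TensorProduct.map (rho k H) LinearMap.id ∘ₗ rho k H) =
      toConv (j3.toLinearMap ∘ₗ antipode k) *
        toConv (TensorProduct.map (rho k H) LinearMap.id ∘ₗ comul) := by
    ext x
    rw [(ℛ k x).convMul_apply]
    simp only [LinearMap.comp_apply, rho_apply (ℛ k x), map_sum]
    refine Finset.sum_congr rfl fun i _ => ?_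
    generalize (comul ((ℛ k x).right i) : H ⊗[k] H) = t
    induction t with
    | zero => simp
    | add x y hx hy => simp only [mul_add, map_add, hx, hy]
    | tmul x y => simp [hj3]
  have := congrArg (fun q : WithConv (H →ₗ[k] (H ⊗[k] H) ⊗[k] H) => q h)
    (show toConv (TensorProduct.map (rho k H) LinearMap.id ∘ₗ rho k H) =
      toConv (g.toLinearMap ∘ₗ rho k H) by rw [hL, hL1, hR, hS, mul_assoc])
  exact this
end Generic
end YDGen


namespace HomHopf

variable (k : Type) [Field k]

/-- A Hom-algebra. -/
structure HomAlg (A : Type) [AddCommGroup A] [Module k A] : Type where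
  mul : A →ₗ[k] A →ₗ[k] A
  one : A
  zmap : A →ₗ[k] A
  zmap_mul : ∀ a b, zmap (mul a b) = mul (zmap a) (zmap b)
  hom_assoc : ∀ a b c, mul (zmap a) (mul b c) = mul (mul a b) (zmap c)
  zmap_one : zmap one = one
  one_mul : ∀ a, mul one a = zmap a
  mul_one : ∀ a, mul a one = zmap a

/-- A Hom-bialgebra. -/
structure Bialg (H : Type) [AddCommGroup H] [Module k H] : Type where
  mul : H →ₗ[k] H →ₗ[k] H
  one : H
  comul : H →ₗ[k] H ⊗[k] H
  counit : H →ₗ[k] k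
  bmap : H →ₗ[k] H
  bmap_mul : ∀ a b, bmap (mul a b) = mul (bmap a) (bmap b)
  hom_assoc : ∀ a b c, mul (bmap a) (mul b c) = mul (mul a b) (bmap c)
  bmap_one : bmap one = one
  one_mul : ∀ a, mul one a = bmap a
  mul_one : ∀ a, mul a one = bmap a
  comul_bmap : ∀ c, comul (bmap c) = TensorProduct.map bmap bmap (comul c)
  coassoc : ∀ c, TensorProduct.map bmap comul (comul c)
      = TensorProduct.assoc k H H H (TensorProduct.map comul bmap (comul c))
  counit_bmap : ∀ c, counit (bmap c) = counit c
  counit_comul : ∀ c,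
      TensorProduct.lid k H (TensorProduct.map counit LinearMap.id (comul c)) = bmap c
  comul_counit : ∀ c,
      TensorProduct.rid k H (TensorProduct.map LinearMap.id counit (comul c)) = bmap c
  comul_mul : ∀ a b, comul (mul a b) = TensorProduct.map₂ mul mul (comul a) (comul b)
  comul_one : comul one = one ⊗ₜ[k] one
  counit_mul : ∀ a b, counit (mul a b) = counit a * counit b
  counit_one : counit one = 1

/-- A Hom-Hopf algebra. -/
structure Hopf (H : Type) [AddCommGroup H] [Module k H] extends Bialg k H where
  S : H →ₗ[k] H
  S_mul_id : ∀ h,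
      TensorProduct.lift mul (TensorProduct.map S LinearMap.id (comul h)) = counit h • one
  id_mul_S : ∀ h,
      TensorProduct.lift mul (TensorProduct.map LinearMap.id S (comul h)) = counit h • one
  S_bmap : ∀ h, S (bmap h) = bmap (S h)

variable {H : Type} [AddCommGroup H] [Module k H]
variable {M N P V W U : Type}
  [AddCommGroup M] [Module k M] [AddCommGroup N] [Module k N]
  [AddCommGroup P] [Module k P] [AddCommGroup V] [Module k V]
  [AddCommGroup W] [Module k W] [AddCommGroup U] [Module k U]

/-- Left Hom-module. -/
structure IsLMod (A : Bialg k H) (ζ : M →ₗ[k] M) (act : H →ₗ[k] M →ₗ[k] M) : Prop where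
  assoc : ∀ a b m, act (A.bmap a) (act b m) = act (A.mul a b) (ζ m)
  zeta_act : ∀ a m, ζ (act a m) = act (A.bmap a) (ζ m)
  one_act : ∀ m, act A.one m = ζ m

/-- Right Hom-module. -/
structure IsRMod (A : Bialg k H) (ζ : M →ₗ[k] M) (ract : M →ₗ[k] H →ₗ[k] M) : Prop where
  assoc : ∀ m a b, ract (ract m a) (A.bmap b) = ract (ζ m) (A.mul a b)
  zeta_act : ∀ m a, ζ (ract m a) = ract (ζ m) (A.bmap a)
  act_one : ∀ m, ract m A.one = ζ m

/-- Left Hom-module over a plain Hom-algebra structure (given by raw data). -/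
structure IsLModOf {A : Type} [AddCommGroup A] [Module k A]
    (mul : A →ₗ[k] A →ₗ[k] A) (one : A) (zmap : A →ₗ[k] A)
    (ζ : M →ₗ[k] M) (act : A →ₗ[k] M →ₗ[k] M) : Prop where
  assoc : ∀ a b m, act (zmap a) (act b m) = act (mul a b) (ζ m)
  zeta_act : ∀ a m, ζ (act a m) = act (zmap a) (ζ m)
  one_act : ∀ m, act one m = ζ m

/-- Right Hom-module over a plain Hom-algebra structure. -/
structure IsRModOf {A : Type} [AddCommGroup A] [Module k A]
    (mul : A →ₗ[k] A →ₗ[k] A) (one : A) (zmap : A →ₗ[k] A)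
    (ζ : M →ₗ[k] M) (ract : M →ₗ[k] A →ₗ[k] M) : Prop where
  assoc : ∀ m a b, ract (ract m a) (zmap b) = ract (ζ m) (mul a b)
  zeta_act : ∀ m a, ζ (ract m a) = ract (ζ m) (zmap a)
  act_one : ∀ m, ract m one = ζ m

/-- Left Hom-comodule. -/
structure IsLCom (A : Bialg k H) (ζ : M →ₗ[k] M) (ρ : M →ₗ[k] H ⊗[k] M) : Prop where
  coact_zeta : ∀ m, ρ (ζ m) = TensorProduct.map A.bmap ζ (ρ m)
  counit_coact : ∀ m, TensorProduct.lid k M (TensorProduct.map A.counit LinearMap.id (ρ m)) = ζ m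
  coassoc : ∀ m, TensorProduct.map A.bmap ρ (ρ m)
      = TensorProduct.assoc k H H M (TensorProduct.map A.comul ζ (ρ m))

/-- Right Hom-comodule. -/
structure IsRCom (A : Bialg k H) (ζ : M →ₗ[k] M) (ρ : M →ₗ[k] M ⊗[k] H) : Prop where
  coact_zeta : ∀ m, ρ (ζ m) = TensorProduct.map ζ A.bmap (ρ m)
  coact_counit : ∀ m, TensorProduct.rid k M (TensorProduct.map LinearMap.id A.counit (ρ m)) = ζ m
  coassoc : ∀ m, TensorProduct.map ρ A.bmap (ρ m)
      = (TensorProduct.assoc k M H H).symm (TensorProduct.map ζ A.comul (ρ m))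

/-- `(h·m)_{[-1]} ⊗ (h·m)_{[0]} = h_1 m_{[-1]} ⊗ h_2 · m_{[0]}`. -/
def LLcompat (A : Bialg k H) (act : H →ₗ[k] M →ₗ[k] M) (ρ : M →ₗ[k] H ⊗[k] M) : Prop :=
  ∀ h m, ρ (act h m) = TensorProduct.map₂ A.mul act (A.comul h) (ρ m)

/-- `(h·m)_{(0)} ⊗ (h·m)_{(1)} = h_1 · m_{(0)} ⊗ h_2 m_{(1)}`. -/
def LRcompat (A : Bialg k H) (act : H →ₗ[k] M →ₗ[k] M) (ρ : M →ₗ[k] M ⊗[k] H) : Prop :=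
  ∀ h m, ρ (act h m) = TensorProduct.map₂ act A.mul (A.comul h) (ρ m)

/-- `(m·h)_{[-1]} ⊗ (m·h)_{[0]} = m_{[-1]} h_1 ⊗ m_{[0]} · h_2`. -/
def RLcompat (A : Bialg k H) (ract : M →ₗ[k] H →ₗ[k] M) (ρ : M →ₗ[k] H ⊗[k] M) : Prop :=
  ∀ m h, ρ (ract m h) = TensorProduct.map₂ A.mul ract (ρ m) (A.comul h)

/-- `(m·h)_{(0)} ⊗ (m·h)_{(1)} = m_{(0)} · h_1 ⊗ m_{(1)} h_2`. -/
def RRcompat (A : Bialg k H) (ract : M →ₗ[k] H →ₗ[k] M) (ρ : M →ₗ[k] M ⊗[k] H) : Prop :=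
  ∀ m h, ρ (ract m h) = TensorProduct.map₂ ract A.mul (ρ m) (A.comul h)

/-- Four-angle H-Hopf module. -/
structure IsFourAngle (A : Hopf k H) (ζ : M →ₗ[k] M)
    (lact : H →ₗ[k] M →ₗ[k] M) (ract : M →ₗ[k] H →ₗ[k] M)
    (ρl : M →ₗ[k] H ⊗[k] M) (ρr : M →ₗ[k] M ⊗[k] H) : Prop where
  lmod : IsLMod k A.toBialg ζ lact
  rmod : IsRMod k A.toBialg ζ ract
  bimod : ∀ a m b, lact (A.bmap a) (ract m b) = ract (lact a m) (A.bmap b)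
  lcom : IsLCom k A.toBialg ζ ρl
  rcom : IsRCom k A.toBialg ζ ρr
  bicom : ∀ m, TensorProduct.map A.bmap ρr (ρl m)
      = TensorProduct.assoc k H M H (TensorProduct.map ρl A.bmap (ρr m))
  cll : LLcompat k A.toBialg lact ρl
  clr : LRcompat k A.toBialg lact ρr
  crl : RLcompat k A.toBialg ract ρl
  crr : RRcompat k A.toBialg ract ρr

/-- Yetter–Drinfel'd compatibility, stated via arbitrary finite representations of `Δ(h)`. -/
def ydCompat (A : Bialg k H) (ract : V →ₗ[k] H →ₗ[k] V) (ρ : V →ₗ[k] V ⊗[k] H) : Prop :=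
  ∀ (v : V) (h : H) (ι : Type) (s : Finset ι) (h1 h2 : ι → H),
    A.comul h = ∑ i ∈ s, h1 i ⊗ₜ[k] h2 i →
    ∑ i ∈ s, TensorProduct.map LinearMap.id (A.mul (A.bmap (A.bmap (h1 i))))
        (ρ (ract v (h2 i)))
      = ∑ i ∈ s, TensorProduct.map (ract.flip (A.bmap (h1 i)))
          (((A.mul.flip (A.bmap (A.bmap (h2 i)))).comp A.bmap)) (ρ v)

/-- Right-right Yetter–Drinfel'd module. -/
structure IsYD (A : Hopf k H) (ζ : V →ₗ[k] V)
    (ract : V →ₗ[k] H →ₗ[k] V) (ρ : V →ₗ[k] V ⊗[k] H) : Prop where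
  rmod : IsRMod k A.toBialg ζ ract
  rcom : IsRCom k A.toBialg ζ ρ
  compat : ydCompat k A.toBialg ract ρ

/-- The braiding `c_{V,W}(v ⊗ w) = ζ_W⁻¹(w_(0)) ⊗ ζ_V⁻¹(v) ◁ β⁻²(w_(1))`. -/
noncomputable def braid (ract : V →ₗ[k] H →ₗ[k] V) (ζVinv : V →ₗ[k] V)
    (ρ : W →ₗ[k] W ⊗[k] H) (ζWinv : W →ₗ[k] W) (βinv : H →ₗ[k] H) :
    V ⊗[k] W →ₗ[k] W ⊗[k] V :=
  (TensorProduct.map LinearMap.id (TensorProduct.lift (ract.comp ζVinv))).comp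
    ((TensorProduct.leftComm k V W H).toLinearMap.comp
      (TensorProduct.map LinearMap.id ((TensorProduct.map ζWinv (βinv.comp βinv)).comp ρ)))

/-- The action on the tensor product of two YD modules:
`(v ⊗ w) ◁ h = v ◁ β⁻¹(h_1) ⊗ w ◁ β⁻¹(h_2)`. -/
noncomputable def ydAct (A : Bialg k H) (βinv : H →ₗ[k] H)
    (ractV : V →ₗ[k] H →ₗ[k] V) (ractW : W →ₗ[k] H →ₗ[k] W) :
    V ⊗[k] W →ₗ[k] H →ₗ[k] V ⊗[k] W :=
  (TensorProduct.map₂ ractV ractW).compl₂ ((TensorProduct.map βinv βinv).comp A.comul)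

/-- The coaction on the tensor product of two YD modules:
`ρ(v ⊗ w) = v_(0) ⊗ w_(0) ⊗ β⁻¹(v_(1) w_(1))`. -/
noncomputable def ydCoact (A : Bialg k H) (βinv : H →ₗ[k] H)
    (ρV : V →ₗ[k] V ⊗[k] H) (ρW : W →ₗ[k] W ⊗[k] H) :
    V ⊗[k] W →ₗ[k] (V ⊗[k] W) ⊗[k] H :=
  (TensorProduct.map LinearMap.id (βinv.comp (TensorProduct.lift A.mul))).comp
    ((TensorProduct.tensorTensorTensorComm k V H W H).toLinearMap.comp
      (TensorProduct.map ρV ρW))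



section Aux
open Coalgebra HopfAlgebra YDGen

/-- The coaction of the statement. -/
noncomputable abbrev coact {k H : Type} [Field k] [AddCommGroup H] [Module k H]
    (A : Hopf k H) (βe : H ≃ₗ[k] H) : H →ₗ[k] H ⊗[k] H :=
      ((TensorProduct.map βe.symm.toLinearMap
          ((TensorProduct.lift A.mul).comp
            (TensorProduct.map
              (A.S.comp (βe.symm.toLinearMap.comp βe.symm.toLinearMap))
              βe.symm.toLinearMap))).comp
        ((TensorProduct.leftComm k H H H).toLinearMap.comp
          ((TensorProduct.assoc k H H H).toLinearMap.comp
            ((TensorProduct.map A.comul LinearMap.id).comp A.comul))))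

theorem yd_aux {k H : Type} [Field k] [Ring H] [HopfAlgebra k H] (A : Hopf k H) (βe : H ≃ₗ[k] H)
    (hβ : ∀ x, A.bmap x = βe x) (hm : ∀ a b, A.mul a b = βe (a * b))
    (hmβ : ∀ a b, βe (a * b) = βe a * βe b)
    (hΔ : ∀ h, A.comul h = TensorProduct.map βe.toLinearMap βe.toLinearMap (comul h))
    (hε : ∀ h, A.counit h = counit h) (hS : ∀ h, A.S h = antipode k h) :
    IsYD k A A.bmap A.mul (coact A βe) := by
  have hb : A.bmap = βe.toLinearMap := LinearMap.ext hβ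
  let φ : H ⊗[k] H →ₗ[k] H ⊗[k] H := TensorProduct.map βe.toLinearMap βe.toLinearMap
  have hφ : ∀ x y, φ (x ⊗ₜ y) = βe x ⊗ₜ βe y := fun x y => rfl
  have hinj : Function.Injective φ := (TensorProduct.congr βe βe).injective
  have hΔβ : ∀ h, comul (βe h) = φ (comul h) := by
    intro h
    apply hinj
    have := A.comul_bmap h
    rw [hb] at this
    rw [hΔ, hΔ] at this
    exact this
  have hSβ : ∀ h, antipode k (βe h) = βe (antipode k h) := by
    intro h
    have := A.S_bmap h
    simpa [hβ, hS] using this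
  have hεβ : ∀ h, (counit (βe h) : k) = counit h := by
    intro h
    have := A.counit_bmap h
    simpa [hβ, hε] using this
  have hT : ∀ h : H, TensorProduct.map comul LinearMap.id (comul (βe h)) =
      TensorProduct.map φ βe.toLinearMap
        (TensorProduct.map (comul (R := k)) LinearMap.id (comul h)) := by
    intro h
    rw [hΔβ]
    generalize (comul h : H ⊗[k] H) = t
    induction t with
    | zero => simp
    | add x y hx hy => simp only [map_add, hx, hy]
    | tmul x y => simp [hφ, hΔβ]
  have hρβ : ∀ h, rho k H (βe h) = φ (rho k H h) := by
    intro h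
    rw [rho_eq, rho_eq, hT]
    generalize (TensorProduct.map (comul (R := k)) LinearMap.id (comul h) : (H ⊗[k] H) ⊗[k] H) = t
    induction t with
    | zero => simp
    | add x y hx hy => simp only [map_add, hx, hy]
    | tmul x y =>
      induction x with
      | zero => simp
      | add x z hx hz => simp only [add_tmul, map_add, hx, hz]
      | tmul x z => simp [hφ, hSβ, hmβ]
  have hρ : ∀ h, coact A βe h = φ (rho k H h) := by
    intro h
    have e : TensorProduct.map A.comul LinearMap.id (A.comul h) =
      TensorProduct.map (φ ∘ₗ φ) βe.toLinearMap
        (TensorProduct.map (comul (R := k)) LinearMap.id (comul h)) := by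
      rw [hΔ]
      generalize (comul h : H ⊗[k] H) = t
      induction t with
      | zero => simp
      | add x y hx hy => simp only [map_add, hx, hy]
      | tmul x y =>
        simp only [TensorProduct.map_tmul, LinearEquiv.coe_coe, LinearMap.id_apply,
          LinearMap.comp_apply]
        rw [hΔ, hΔβ]
    simp only [coact, LinearMap.comp_apply]
    rw [e, rho_eq]
    generalize (TensorProduct.map (comul (R := k)) LinearMap.id (comul h) : (H ⊗[k] H) ⊗[k] H) = t
    induction t with
    | zero => simp
    | add x y hx hy => simp only [map_add, hx, hy]
    | tmul x y =>
      induction x with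
      | zero => simp
      | add x z hx hz => simp only [add_tmul, map_add, hx, hz]
      | tmul x z => simp [hφ, hS, hm]
  refine ⟨⟨fun m a b => (A.hom_assoc m a b).symm, A.bmap_mul, A.mul_one⟩, ⟨?_, ?_, ?_⟩, ?_⟩
  · intro m
    rw [hρ, hρ, hβ, hρβ, hb]
  · intro m
    rw [hρ, hβ]
    conv_rhs => rw [← rho_counit (k := k) m]
    generalize rho k H m = t
    induction t with
    | zero => simp
    | add x y hx hy => simp only [map_add, hx, hy]
    | tmul x y => simp [hφ, hε, hεβ]
  · intro m
    have e1 : ∀ t, TensorProduct.map (coact A βe) A.bmap (φ t) =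
        TensorProduct.map (φ ∘ₗ φ) (βe.toLinearMap ∘ₗ βe.toLinearMap)
          (TensorProduct.map (rho k H) LinearMap.id t) := by
      intro t
      induction t with
      | zero => simp
      | add x y hx hy => simp only [map_add, hx, hy]
      | tmul x y => 
        rw [hφ, TensorProduct.map_tmul, hρ, hρβ, hβ]
        rfl
    have e2 : ∀ t, (TensorProduct.assoc k H H H).symm (TensorProduct.map A.bmap A.comul (φ t)) =
        TensorProduct.map (φ ∘ₗ φ) (βe.toLinearMap ∘ₗ βe.toLinearMap)
          ((TensorProduct.assoc k H H H).symm (TensorProduct.map LinearMap.id comul t)) := by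
      intro t
      induction t with
      | zero => simp
      | add x y hx hy => simp only [map_add, hx, hy]
      | tmul x y =>
        rw [hφ, TensorProduct.map_tmul, TensorProduct.map_tmul, hβ, hΔ, hΔβ]
        generalize (comul y : H ⊗[k] H) = s
        induction s with
        | zero => simp
        | add x y hx hy => simp only [tmul_add, map_add, hx, hy]
        | tmul x y => simp [hφ]
    rw [hρ, e1, e2, rho_coassoc]
  · intro v h ι s h1 h2 hs
    let r : Repr k (βe h) ι := ⟨s, h1, h2, by rw [← hs, hΔ, hΔβ]⟩
    let ψ : H ⊗[k] H →ₗ[k] H ⊗[k] H := TensorProduct.map (βe.toLinearMap ∘ₗ βe.toLinearMap)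
      (βe.toLinearMap ∘ₗ βe.toLinearMap ∘ₗ βe.toLinearMap)
    have key := congrArg ψ (rho_compat v (βe h) r)
    rw [← r.eq, Finset.mul_sum, map_sum, map_sum] at key
    have e1 : ∀ (a : H) t, TensorProduct.map LinearMap.id (A.mul (A.bmap (A.bmap a))) (φ (φ t)) =
        ψ ((1 ⊗ₜ a) * t) := by
      intro a t
      induction t with
      | zero => simp
      | add x y hx hy => simp only [mul_add, map_add, hx, hy]
      | tmul x y => simp [hφ, ψ, hm, hβ, hmβ]
    have e2 : ∀ (a b : H) t, TensorProduct.map (A.mul.flip (A.bmap a))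
          (((A.mul.flip (A.bmap (A.bmap b))).comp A.bmap)) (φ t) =
        ψ (t * (a ⊗ₜ b)) := by
      intro a b t
      induction t with
      | zero => simp
      | add x y hx hy => simp only [add_mul, map_add, hx, hy]
      | tmul x y => simp [hφ, ψ, hm, hβ, hmβ]
    simp only [hρ, hm, hρβ, e1, e2]
    exact key

end Aux


section Untwist

variable {k H : Type} [Field k] [AddCommGroup H] [Module k H]

/-- The untwisted ring. -/
noncomputable abbrev uRing (A : Hopf k H) (βe : H ≃ₗ[k] H) (hb : ∀ x, A.bmap x = βe x) :
    Ring H :=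
  have hs : ∀ a b, βe.symm (A.mul a b) = A.mul (βe.symm a) (βe.symm b) := by
    intro a b
    apply βe.injective
    rw [← hb (A.mul _ _), A.bmap_mul]
    simp [hb]
  { (inferInstance : AddCommGroup H) with
    mul := fun a b => βe.symm (A.mul a b)
    one := A.one
    zero_mul := fun a => by change βe.symm (A.mul 0 a) = 0; simp
    mul_zero := fun a => by change βe.symm (A.mul a 0) = 0; simp
    left_distrib := fun a b c => by
      change βe.symm (A.mul a (b + c)) = βe.symm (A.mul a b) + βe.symm (A.mul a c); simp
    right_distrib := fun a b c => by
      change βe.symm (A.mul (a + b) c) = βe.symm (A.mul a c) + βe.symm (A.mul b c); simp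
    one_mul := fun a => by change βe.symm (A.mul A.one a) = a; rw [A.one_mul, hb]; simp
    mul_one := fun a => by change βe.symm (A.mul a A.one) = a; rw [A.mul_one, hb]; simp
    mul_assoc := fun a b c => by
      change βe.symm (A.mul (βe.symm (A.mul a b)) c) = βe.symm (A.mul a (βe.symm (A.mul b c)))
      have := A.hom_assoc (βe.symm a) (βe.symm b) (βe.symm c)
      rw [hb, hb] at this
      simp only [LinearEquiv.apply_symm_apply] at this
      rw [hs a b, hs b c, this] }

/-- The untwisted algebra. -/
noncomputable abbrev uAlg (A : Hopf k H) (βe : H ≃ₗ[k] H) (hb : ∀ x, A.bmap x = βe x) :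
    @Algebra k H _ (uRing A βe hb).toSemiring :=
  letI := uRing A βe hb
  Algebra.ofModule
    (fun r x y => by
      change βe.symm (A.mul (r • x) y) = r • βe.symm (A.mul x y); simp)
    (fun r x y => by
      change βe.symm (A.mul x (r • y)) = r • βe.symm (A.mul x y); simp)

/-- The untwisted comultiplication. -/
noncomputable def uComul (A : Hopf k H) (βe : H ≃ₗ[k] H) : H →ₗ[k] H ⊗[k] H :=
  TensorProduct.map βe.symm.toLinearMap βe.symm.toLinearMap ∘ₗ A.comul

lemma comul_eq (A : Hopf k H) (βe : H ≃ₗ[k] H) (h : H) :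
    A.comul h = TensorProduct.map βe.toLinearMap βe.toLinearMap (uComul A βe h) := by
  simp only [uComul, LinearMap.comp_apply]
  rw [← LinearMap.comp_apply, ← TensorProduct.map_comp]
  simp

lemma uComul_symm (A : Hopf k H) (βe : H ≃ₗ[k] H) (hb : ∀ x, A.bmap x = βe x) (h : H) :
    uComul A βe (βe.symm h) =
      TensorProduct.map βe.symm.toLinearMap βe.symm.toLinearMap (uComul A βe h) := by
  have hb' : A.bmap = βe.toLinearMap := LinearMap.ext hb
  have := A.comul_bmap (βe.symm h)
  rw [hb] at this
  rw [LinearEquiv.apply_symm_apply] at this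
  simp only [uComul, LinearMap.comp_apply]
  rw [this, hb']
  congr 1
  rw [← LinearMap.comp_apply, ← TensorProduct.map_comp]
  simp

lemma uCoassoc (A : Hopf k H) (βe : H ≃ₗ[k] H) (hb : ∀ x, A.bmap x = βe x) (h : H) :
    TensorProduct.assoc k H H H ((uComul A βe).rTensor H (uComul A βe h)) =
      (uComul A βe).lTensor H (uComul A βe h) := by
  have hb' : A.bmap = βe.toLinearMap := LinearMap.ext hb
  have := A.coassoc h
  rw [hb'] at this
  let s := βe.symm.toLinearMap
  let σ : H ⊗[k] H →ₗ[k] H ⊗[k] H := TensorProduct.map s s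
  have h1 : ∀ t : H ⊗[k] H, (uComul A βe).lTensor H (σ t) =
      TensorProduct.map (s ∘ₗ s) (σ ∘ₗ σ) (TensorProduct.map βe.toLinearMap A.comul t) := by
    intro t
    induction t with
    | zero => simp
    | add x y hx hy => simp only [map_add, hx, hy]
    | tmul x y =>
      simp only [σ, s, TensorProduct.map_tmul, LinearMap.lTensor_tmul, LinearEquiv.coe_coe,
        LinearMap.comp_apply, LinearEquiv.symm_apply_apply]
      rw [uComul_symm A βe hb]; rfl
  have h2 : ∀ t : H ⊗[k] H, (uComul A βe).rTensor H (σ t) =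
      TensorProduct.map (σ ∘ₗ σ) (s ∘ₗ s) (TensorProduct.map A.comul βe.toLinearMap t) := by
    intro t
    induction t with
    | zero => simp
    | add x y hx hy => simp only [map_add, hx, hy]
    | tmul x y =>
      simp only [σ, s, TensorProduct.map_tmul, LinearMap.rTensor_tmul, LinearEquiv.coe_coe,
        LinearMap.comp_apply, LinearEquiv.symm_apply_apply]
      rw [uComul_symm A βe hb]; rfl
  have h3 : ∀ t : (H ⊗[k] H) ⊗[k] H, TensorProduct.assoc k H H H
      (TensorProduct.map (σ ∘ₗ σ) (s ∘ₗ s) t) =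
      TensorProduct.map (s ∘ₗ s) (σ ∘ₗ σ) (TensorProduct.assoc k H H H t) := by
    intro t
    induction t with
    | zero => simp
    | add x y hx hy => simp only [map_add, hx, hy]
    | tmul x y =>
      induction x with
      | zero => simp
      | add x z hx hz => simp only [add_tmul, map_add, hx, hz]
      | tmul x z => simp [σ]
  change TensorProduct.assoc k H H H ((uComul A βe).rTensor H (σ (A.comul h))) =
      (uComul A βe).lTensor H (σ (A.comul h))
  rw [h1, h2, h3, this]

/-- The untwisted coalgebra. -/
noncomputable abbrev uCoalg (A : Hopf k H) (βe : H ≃ₗ[k] H) (hb : ∀ x, A.bmap x = βe x) :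
    Coalgebra k H :=
  have hε : ∀ x, A.counit (βe.symm x) = A.counit x := fun x => by
    have := A.counit_bmap (βe.symm x)
    rw [hb] at this
    simpa using this.symm
  { comul := uComul A βe
    counit := A.counit
    coassoc := LinearMap.ext fun h => uCoassoc A βe hb h
    rTensor_counit_comp_comul := by
      ext h
      have h1 : ∀ t : H ⊗[k] H, A.counit.rTensor H
          (TensorProduct.map βe.symm.toLinearMap βe.symm.toLinearMap t) =
          1 ⊗ₜ βe.symm (TensorProduct.lid k H (TensorProduct.map A.counit LinearMap.id t)) := by
        intro t
        induction t with
        | zero => simp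
        | add x y hx hy => simp only [map_add, tmul_add, hx, hy]
        | tmul x y =>
          simp only [TensorProduct.map_tmul, LinearMap.rTensor_tmul, LinearEquiv.coe_coe, hε,
            TensorProduct.lid_tmul, LinearMap.id_apply, map_smul]
          rw [← TensorProduct.smul_tmul]; simp
      change A.counit.rTensor H (TensorProduct.map βe.symm.toLinearMap βe.symm.toLinearMap
        (A.comul h)) = 1 ⊗ₜ h
      rw [h1, A.counit_comul, hb]; simp
    lTensor_counit_comp_comul := by
      ext h
      have h1 : ∀ t : H ⊗[k] H, A.counit.lTensor H
          (TensorProduct.map βe.symm.toLinearMap βe.symm.toLinearMap t) =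
          βe.symm (TensorProduct.rid k H (TensorProduct.map LinearMap.id A.counit t)) ⊗ₜ 1 := by
        intro t
        induction t with
        | zero => simp
        | add x y hx hy => simp only [map_add, add_tmul, hx, hy]
        | tmul x y =>
          simp only [TensorProduct.map_tmul, LinearMap.lTensor_tmul, LinearEquiv.coe_coe, hε,
            TensorProduct.rid_tmul, LinearMap.id_apply, map_smul]
          rw [TensorProduct.smul_tmul]; simp
      change A.counit.lTensor H (TensorProduct.map βe.symm.toLinearMap βe.symm.toLinearMap
        (A.comul h)) = h ⊗ₜ 1
      rw [h1, A.comul_counit, hb]; simp }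

/-- The untwisted bialgebra. -/
noncomputable abbrev uBialg (A : Hopf k H) (βe : H ≃ₗ[k] H) (hb : ∀ x, A.bmap x = βe x) :
    @Bialgebra k H _ (uRing A βe hb).toSemiring :=
  letI := uRing A βe hb
  letI := uAlg A βe hb
  letI := uCoalg A βe hb
  have hε : ∀ x, A.counit (βe.symm x) = A.counit x := fun x => by
    have := A.counit_bmap (βe.symm x)
    rw [hb] at this
    simpa using this.symm
  Bialgebra.mk' k H A.counit_one
    (fun {a b} => by
      change A.counit (βe.symm (A.mul a b)) = _
      rw [hε, A.counit_mul]; rfl)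
    (by
      change TensorProduct.map βe.symm.toLinearMap βe.symm.toLinearMap (A.comul A.one) =
        A.one ⊗ₜ A.one
      have h1 : βe.symm A.one = A.one := by
        rw [LinearEquiv.symm_apply_eq, ← hb, A.bmap_one]
      rw [A.comul_one, TensorProduct.map_tmul]
      simp [h1])
    (fun {a b} => by
      change uComul A βe (βe.symm (A.mul a b)) = uComul A βe a * uComul A βe b
      have hs : ∀ a b, βe.symm (A.mul a b) = A.mul (βe.symm a) (βe.symm b) := by
        intro a b
        apply βe.injective
        rw [← hb (A.mul _ _), A.bmap_mul]
        simp [hb]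
      have h1 : ∀ s t : H ⊗[k] H, TensorProduct.map βe.symm.toLinearMap βe.symm.toLinearMap
          (TensorProduct.map βe.symm.toLinearMap βe.symm.toLinearMap
            (TensorProduct.map₂ A.mul A.mul s t)) =
          TensorProduct.map βe.symm.toLinearMap βe.symm.toLinearMap s *
            TensorProduct.map βe.symm.toLinearMap βe.symm.toLinearMap t := by
        intro s t
        induction s with
        | zero => simp
        | add x y hx hy => simp only [map_add, add_mul, LinearMap.add_apply, hx, hy]
        | tmul x y =>
          induction t with
          | zero => simp
          | add x y hx hy => simp only [map_add, mul_add, hx, hy]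
          | tmul z w =>
            simp only [TensorProduct.map_tmul, TensorProduct.map₂_apply_tmul,
              LinearEquiv.coe_coe, Algebra.TensorProduct.tmul_mul_tmul]
            rw [hs x z, hs y w]
            rfl
      rw [uComul_symm A βe hb]
      simp only [uComul, LinearMap.comp_apply]
      rw [A.comul_mul]
      exact h1 _ _)

/-- The untwisted Hopf algebra. -/
noncomputable abbrev uHopf (A : Hopf k H) (βe : H ≃ₗ[k] H) (hb : ∀ x, A.bmap x = βe x) :
    @HopfAlgebra k H _ (uRing A βe hb).toSemiring :=
  letI := uRing A βe hb
  letI := uBialg A βe hb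
  have h1 : βe.symm A.one = A.one := by
    rw [LinearEquiv.symm_apply_eq, ← hb, A.bmap_one]
  have hs : ∀ a b, βe.symm (A.mul a b) = A.mul (βe.symm a) (βe.symm b) := by
    intro a b
    apply βe.injective
    rw [← hb (A.mul _ _), A.bmap_mul]
    simp [hb]
  have hS : ∀ a, A.S (βe.symm a) = βe.symm (A.S a) := by
    intro a
    apply βe.injective
    rw [← hb (A.S _), ← A.S_bmap]
    simp [hb]
  { antipode := A.S
    mul_antipode_rTensor_comul := by
      refine LinearMap.ext fun h => ?_
      change LinearMap.mul' k H (A.S.rTensor H (TensorProduct.map βe.symm.toLinearMap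
        βe.symm.toLinearMap (A.comul h))) = A.counit h • A.one
      have h2 : ∀ t : H ⊗[k] H, LinearMap.mul' k H (A.S.rTensor H
          (TensorProduct.map βe.symm.toLinearMap βe.symm.toLinearMap t)) =
          βe.symm (βe.symm
            (TensorProduct.lift A.mul (TensorProduct.map A.S LinearMap.id t))) := by
        intro t
        induction t with
        | zero => simp
        | add x y hx hy => simp only [map_add, hx, hy]
        | tmul x y =>
          change βe.symm (A.mul (A.S (βe.symm x)) (βe.symm y)) =
            βe.symm (βe.symm (A.mul (A.S x) y))
          rw [hs (A.S x), hS]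
      rw [h2, A.S_mul_id, map_smul, map_smul, h1, h1]
    mul_antipode_lTensor_comul := by
      refine LinearMap.ext fun h => ?_
      change LinearMap.mul' k H (A.S.lTensor H (TensorProduct.map βe.symm.toLinearMap
        βe.symm.toLinearMap (A.comul h))) = A.counit h • A.one
      have h2 : ∀ t : H ⊗[k] H, LinearMap.mul' k H (A.S.lTensor H
          (TensorProduct.map βe.symm.toLinearMap βe.symm.toLinearMap t)) =
          βe.symm (βe.symm
            (TensorProduct.lift A.mul (TensorProduct.map LinearMap.id A.S t))) := by
        intro t
        induction t with
        | zero => simp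
        | add x y hx hy => simp only [map_add, hx, hy]
        | tmul x y =>
          change βe.symm (A.mul (βe.symm x) (A.S (βe.symm y))) =
            βe.symm (βe.symm (A.mul x (A.S y)))
          rw [hs x, hS]
      rw [h2, A.id_mul_S, map_smul, map_smul, h1, h1] }

end Untwist

/-- `H` is a right-right Yetter–Drinfel'd module over itself with action the
multiplication and coaction `ρ(h) = β⁻¹(h_{12}) ⊗ Sβ⁻²(h_{11})β⁻¹(h_2)`. -/
theorem self_yd_mult (H : Type) [AddCommGroup H] [Module k H]
    (A : Hopf k H) (βe : H ≃ₗ[k] H) (hβ : βe.toLinearMap = A.bmap) :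
    IsYD k A A.bmap A.mul
      ((TensorProduct.map βe.symm.toLinearMap
          ((TensorProduct.lift A.mul).comp
            (TensorProduct.map
              (A.S.comp (βe.symm.toLinearMap.comp βe.symm.toLinearMap))
              βe.symm.toLinearMap))).comp
        ((TensorProduct.leftComm k H H H).toLinearMap.comp
          ((TensorProduct.assoc k H H H).toLinearMap.comp
            ((TensorProduct.map A.comul LinearMap.id).comp A.comul)))) := by
  have hb : ∀ x, A.bmap x = βe x := fun x => by rw [← hβ]; rfl
  let r := uRing A βe hb
  let u := uHopf A βe hb
  refine yd_aux (k := k) (H := H) A βe hb (fun a b => ?_) (fun a b => ?_) (fun h => ?_)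
    (fun h => rfl) (fun h => rfl)
  · change _ = βe (βe.symm (A.mul a b))
    simp
  · change βe (βe.symm (A.mul a b)) = βe.symm (A.mul (βe a) (βe b))
    rw [← hb a, ← hb b, ← A.bmap_mul, hb]
    simp
  · exact comul_eq A βe h

end HomHopf
end

section
/- Let (H, β) be a Hom-Hopf algebra with antipode S such that the canonical braiding of the category of right-right Yetter-Drinfel'd modules is a symmetry (c_{W,V} ∘ c_{V,W} = id for all YD modules V, W). Then H = k·1_H, i.e. every x ∈ H equals ε(x)1_H. -/
open TensorProduct

namespace HomHopf

variable (k : Type) [Field k]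

variable {H : Type} [AddCommGroup H] [Module k H]
variable {M N P V W U : Type}
  [AddCommGroup M] [Module k M] [AddCommGroup N] [Module k N]
  [AddCommGroup P] [Module k P] [AddCommGroup V] [Module k V]
  [AddCommGroup W] [Module k W] [AddCommGroup U] [Module k U]

section Classical1

open TensorProduct WithConv Coalgebra

variable {k H : Type} [Field k] [Ring H] [HopfAlgebra k H]

local notation "SS" => HopfAlgebra.antipode k (A := H)

/-- adjoint action -/
noncomputable def adj (k H : Type) [Field k] [Ring H] [HopfAlgebra k H] : H →ₗ[k] H →ₗ[k] H :=
  LinearMap.mk₂ k (fun x h => LinearMap.mul' k H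
      (TensorProduct.map (HopfAlgebra.antipode k (A := H)) (LinearMap.mulLeft k x) (comul h)))
    (fun x y h => by
      have : LinearMap.mulLeft k (x + y) = LinearMap.mulLeft k x + LinearMap.mulLeft k y := by
        ext; simp [add_mul]
      simp [this, TensorProduct.map_add_right])
    (fun c x h => by
      have : LinearMap.mulLeft k (c • x) = c • LinearMap.mulLeft k x := by
        ext; simp
      simp [this, TensorProduct.map_smul_right])
    (fun x h h' => by simp)
    (fun c x h => by simp)

lemma adj_apply (x h : H) : adj k H x h = LinearMap.mul' k H
      (TensorProduct.map SS (LinearMap.mulLeft k x) (comul h)) := rfl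

lemma adj_conv (x h : H) : adj k H x h = (toConv SS * toConv (LinearMap.mulLeft k x)) h := rfl

lemma adj_repr (x : H) {h : H} {ι : Type*} (R : Repr k h ι) :
    adj k H x h = ∑ i ∈ R.index, SS (R.left i) * (x * R.right i) := by
  rw [adj_conv, R.convMul_apply]; rfl

lemma adj_one (x : H) : adj k H x 1 = x := by
  simp [adj_apply, Algebra.TensorProduct.one_def]

lemma adj_adj (x a b : H) : adj k H (adj k H x a) b = adj k H x (a * b) := by
  rw [adj_repr x ((ℛ k a).mul (ℛ k b)), adj_repr _ (ℛ k b), adj_repr _ (ℛ k a)]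
  simp only [Repr.mul_index, Repr.mul_left, Repr.mul_right, Finset.sum_product_right,
    HopfAlgebra.antipode_mul_antidistrib, Finset.mul_sum, Finset.sum_mul, mul_assoc]

section B
variable {B : Type} [Ring B] [Algebra k B]

/-- f∘S -/
lemma hom_mul_S (f : H →ₐ[k] B) :
    toConv f.toLinearMap * toConv (f.toLinearMap ∘ₗ SS) = 1 := by
  have := LinearMap.algHom_comp_convMul_distrib f (toConv LinearMap.id) (toConv SS)
  rw [LinearMap.id_mul_antipode] at this
  apply WithConv.ofConv_injective
  refine Eq.trans this.symm ?_
  ext; simp [LinearMap.convOne_def]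

lemma S_mul_hom (f : H →ₐ[k] B) :
    toConv (f.toLinearMap ∘ₗ SS) * toConv f.toLinearMap = 1 := by
  have := LinearMap.algHom_comp_convMul_distrib f (toConv SS) (toConv LinearMap.id)
  rw [LinearMap.antipode_mul_id] at this
  apply WithConv.ofConv_injective
  refine Eq.trans this.symm ?_
  ext; simp [LinearMap.convOne_def]

end B

local notation "i1" => (Algebra.TensorProduct.includeLeft : H →ₐ[k] H ⊗[k] H)
local notation "i2" => (Algebra.TensorProduct.includeRight : H →ₐ[k] H ⊗[k] H)
local notation "DD" => Bialgebra.comulAlgHom k H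

lemma map_comp_comul {B C : Type} [Ring B] [Algebra k B] [Ring C] [Algebra k C]
    (f : H →ₗ[k] B) (g : H →ₗ[k] C) :
    toConv (TensorProduct.map f g ∘ₗ comul) =
      toConv ((Algebra.TensorProduct.includeLeft : B →ₐ[k] B ⊗[k] C).toLinearMap ∘ₗ f) *
      toConv ((Algebra.TensorProduct.includeRight : C →ₐ[k] B ⊗[k] C).toLinearMap ∘ₗ g) := by
  ext h
  rw [(ℛ k h).convMul_apply]
  simp [← (ℛ k h).eq]

lemma D_eq : toConv (DD).toLinearMap = toConv (i1).toLinearMap * toConv (i2).toLinearMap := by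
  have := map_comp_comul (k := k) (H := H) LinearMap.id LinearMap.id
  rw [TensorProduct.map_id] at this
  exact this

lemma i2_mul_DS : toConv (i2).toLinearMap * toConv ((DD).toLinearMap ∘ₗ SS)
    = toConv ((i1).toLinearMap ∘ₗ SS) := by
  have h : toConv (i2).toLinearMap =
      toConv ((i1).toLinearMap ∘ₗ SS) * toConv (DD).toLinearMap := by
    rw [D_eq, ← mul_assoc, S_mul_hom, one_mul]
  rw [h, mul_assoc, hom_mul_S, mul_one]

lemma adj_yd_rhs (t : H ⊗[k] H) (h : H) {ι : Type*} (R : Repr k h ι) :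
    ∑ i ∈ R.index, TensorProduct.map ((adj k H).flip (R.left i))
      (LinearMap.mulRight k (R.right i)) t
    = (toConv ((i1).toLinearMap ∘ₗ SS) *
        toConv (LinearMap.mulLeft k t ∘ₗ (DD).toLinearMap)) h := by
  induction t with
  | zero => simp
  | add a b ha hb =>
    have : LinearMap.mulLeft k (a + b) = LinearMap.mulLeft k a + LinearMap.mulLeft k b := by
      ext; simp [add_mul]
    simp only [map_add, Finset.sum_add_distrib, ha, hb, this, LinearMap.add_comp, toConv_add,
      mul_add]
    rfl
  | tmul p q =>
    have h1 : toConv (LinearMap.mulLeft k (p ⊗ₜ[k] q) ∘ₗ (DD).toLinearMap) =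
        toConv ((i1).toLinearMap ∘ₗ LinearMap.mulLeft k p) *
        toConv ((i2).toLinearMap ∘ₗ LinearMap.mulLeft k q) := by
      rw [← map_comp_comul]
      ext x
      simp [← (ℛ k x).eq, Finset.mul_sum]
    have h2 := LinearMap.algHom_comp_convMul_distrib (i1) (toConv SS)
      (toConv (LinearMap.mulLeft k p))
    rw [h1, ← mul_assoc, R.convMul_apply]
    refine Finset.sum_congr rfl fun i _ => ?_
    have h3 := congrArg (fun f => f (R.left i)) h2
    have h4 : (toConv ((i1).toLinearMap ∘ₗ SS) *
        toConv ((i1).toLinearMap ∘ₗ LinearMap.mulLeft k p)) (R.left i) =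
        (i1) (adj k H p (R.left i)) := h3.symm
    rw [h4]
    simp

lemma adj_yd (x h : H) {ι : Type*} (R : Repr k h ι) :
    ∑ i ∈ R.index, TensorProduct.map LinearMap.id (LinearMap.mulLeft k (R.left i))
      (comul (R := k) (adj k H x (R.right i)))
    = ∑ i ∈ R.index, TensorProduct.map ((adj k H).flip (R.left i))
      (LinearMap.mulRight k (R.right i)) (comul (R := k) x) := by
  rw [adj_yd_rhs, ← i2_mul_DS, mul_assoc, R.convMul_apply]
  refine Finset.sum_congr rfl fun i _ => ?_
  have h2 := LinearMap.algHom_comp_convMul_distrib (DD) (toConv SS)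
      (toConv (LinearMap.mulLeft k x))
  have h3 : (toConv ((DD).toLinearMap ∘ₗ SS) *
      toConv ((DD).toLinearMap ∘ₗ LinearMap.mulLeft k x)) (R.right i) =
        comul (adj k H x (R.right i)) := (congrArg (fun f => f (R.right i)) h2).symm
  have h4 : (LinearMap.mulLeft k (comul (R := k) x) ∘ₗ (DD).toLinearMap) =
      ((DD).toLinearMap ∘ₗ LinearMap.mulLeft k x) := by
    ext y; simp
  have h5 : ∀ (a : H) (t : H ⊗[k] H), TensorProduct.map LinearMap.id (LinearMap.mulLeft k a) t
      = (i2) a * t := by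
    intro a t
    induction t with
    | zero => simp
    | add a b ha hb => rw [map_add, ha, hb, mul_add]
    | tmul p q => simp
  rw [h4, h3, h5]
  rfl

/-- coadjoint coaction -/
noncomputable def coadj (k H : Type) [Field k] [Ring H] [HopfAlgebra k H] : H →ₗ[k] H ⊗[k] H :=
  (toConv ((Algebra.TensorProduct.includeRight : H →ₐ[k] H ⊗[k] H).toLinearMap ∘ₗ
    HopfAlgebra.antipode k (A := H)) * toConv (Bialgebra.comulAlgHom k H).toLinearMap).ofConv

lemma coadj_repr {h : H} {ι : Type*} (R : Repr k h ι) :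
    coadj k H h = ∑ i ∈ R.index, (1 ⊗ₜ[k] SS (R.left i)) * comul (R.right i) :=
  R.convMul_apply _ _

lemma coadj_one : coadj k H 1 = 1 := by
  change LinearMap.mul' k (H ⊗[k] H) (TensorProduct.map _ _ (comul 1)) = _
  simp [Algebra.TensorProduct.one_def]

lemma coadj_counit (m : H) :
    TensorProduct.rid k H (TensorProduct.map LinearMap.id counit (coadj k H m)) = m := by
  let E : H ⊗[k] H →ₐ[k] H := (Algebra.TensorProduct.rid k k H).toAlgHom.comp
    (Algebra.TensorProduct.map (AlgHom.id k H) (Bialgebra.counitAlgHom k H))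
  have h2 := LinearMap.algHom_comp_convMul_distrib E (toConv ((i2).toLinearMap ∘ₗ SS))
    (toConv (DD).toLinearMap)
  have h3 : toConv (E.toLinearMap ∘ₗ ((i2).toLinearMap ∘ₗ SS)) = 1 := by
    ext x; simp [E, Algebra.algebraMap_eq_smul_one]
  have h4 : toConv (E.toLinearMap ∘ₗ (DD).toLinearMap) = toConv LinearMap.id := by
    ext x
    have := congrArg (TensorProduct.rid k H) (Coalgebra.lTensor_counit_comul (R := k) x)
    simp only [TensorProduct.rid_tmul, one_smul] at this
    exact this
  simp only [ofConv_toConv] at h2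
  rw [h3, h4, one_mul] at h2
  exact congrArg (fun f => f m) h2

local notation "j12" => (Algebra.TensorProduct.includeLeft :
  H ⊗[k] H →ₐ[k] (H ⊗[k] H) ⊗[k] H)
local notation "j3" => (Algebra.TensorProduct.includeRight :
  H →ₐ[k] (H ⊗[k] H) ⊗[k] H)

lemma coadj_coassoc (m : H) :
    TensorProduct.map (coadj k H) LinearMap.id (coadj k H m) =
      (TensorProduct.assoc k H H H).symm
        (TensorProduct.map LinearMap.id comul (coadj k H m)) := by
  let Φ : H ⊗[k] H →ₐ[k] (H ⊗[k] H) ⊗[k] H :=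
    (Algebra.TensorProduct.assoc k k k H H H).symm.toAlgHom.comp
    (Algebra.TensorProduct.map (AlgHom.id k H) (DD))
  have hl : TensorProduct.map (coadj k H) LinearMap.id (coadj k H m) =
      (toConv ((j3).toLinearMap ∘ₗ SS) *
        (toConv ((j12).toLinearMap ∘ₗ coadj k H) * toConv (j3).toLinearMap)) m := by
    rw [coadj_repr (ℛ k m), (ℛ k m).convMul_apply, map_sum]
    refine Finset.sum_congr rfl fun i _ => ?_
    have h1 := map_comp_comul (coadj k H) (LinearMap.id (R := k) (M := H))
    rw [LinearMap.comp_id] at h1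
    rw [← h1]
    have : ∀ (c : H) (t : H ⊗[k] H), TensorProduct.map (coadj k H) LinearMap.id
        ((1 ⊗ₜ[k] c) * t) = (j3) c * TensorProduct.map (coadj k H) LinearMap.id t := by
      intro c t
      induction t with
      | zero => simp
      | add a b ha hb => rw [mul_add, map_add, ha, hb, map_add, mul_add]
      | tmul p q => simp
    exact this _ _
  have h2 := LinearMap.algHom_comp_convMul_distrib Φ (toConv ((i2).toLinearMap ∘ₗ SS))
    (toConv (DD).toLinearMap)
  have hr : (TensorProduct.assoc k H H H).symm
        (TensorProduct.map LinearMap.id comul (coadj k H m)) =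
      (toConv ((Φ.comp i2).toLinearMap ∘ₗ SS) *
        toConv (Φ.toLinearMap ∘ₗ (DD).toLinearMap)) m :=
    congrArg (fun f => f m) h2
  have h3 : toConv (Φ.toLinearMap ∘ₗ (DD).toLinearMap) =
      toConv ((j12).toLinearMap ∘ₗ (DD).toLinearMap) * toConv (j3).toLinearMap := by
    have h1 := map_comp_comul (DD).toLinearMap (LinearMap.id (R := k) (M := H))
    rw [LinearMap.comp_id] at h1
    rw [← h1]
    ext x
    exact Coalgebra.coassoc_symm_apply (R := k) x
  have h4 : toConv (Φ.comp i2).toLinearMap =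
      toConv ((j12).comp i2).toLinearMap * toConv (j3).toLinearMap := by
    have h1 := map_comp_comul (i2).toLinearMap (LinearMap.id (R := k) (M := H))
    rw [LinearMap.comp_id] at h1
    refine Eq.trans ?_ h1
    ext x
    simp [Φ, ← (ℛ k x).eq, TensorProduct.tmul_sum]
  have h5 : toConv ((Φ.comp i2).toLinearMap ∘ₗ SS) =
      toConv ((j3).toLinearMap ∘ₗ SS) * toConv (((j12).comp i2).toLinearMap ∘ₗ SS) := by
    refine left_inv_eq_right_inv (S_mul_hom _) ?_
    rw [h4, mul_assoc, ← mul_assoc (toConv (j3).toLinearMap), hom_mul_S, one_mul, hom_mul_S]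
  have h6 : toConv ((j12).toLinearMap ∘ₗ coadj k H) =
      toConv (((j12).comp i2).toLinearMap ∘ₗ SS) *
       toConv ((j12).toLinearMap ∘ₗ (DD).toLinearMap) :=
    congrArg toConv (LinearMap.algHom_comp_convMul_distrib (j12)
      (toConv ((i2).toLinearMap ∘ₗ SS)) (toConv (DD).toLinearMap))
  rw [hl, hr, h3, h5, h6]
  simp only [mul_assoc]

lemma coadj_mul (v a : H) : coadj k H (v * a) =
    (toConv ((i2).toLinearMap ∘ₗ SS) *
      toConv (LinearMap.mulLeft k (coadj k H v) ∘ₗ (DD).toLinearMap)) a := by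
  rw [(ℛ k a).convMul_apply, coadj_repr ((ℛ k v).mul (ℛ k a)), coadj_repr (ℛ k v)]
  have h : ∀ x y : H, (1 : H) ⊗ₜ[k] (x * y) = (1 ⊗ₜ x) * (1 ⊗ₜ y) := by intros; simp
  simp [Repr.mul_index, Repr.mul_left, Repr.mul_right, Finset.sum_product_right,
    HopfAlgebra.antipode_mul_antidistrib, Finset.mul_sum, Finset.sum_mul, mul_assoc, h,
    -Algebra.TensorProduct.tmul_mul_tmul]

lemma coadj_yd (v h : H) {ι : Type*} (R : Repr k h ι) :
    ∑ i ∈ R.index, TensorProduct.map LinearMap.id (LinearMap.mulLeft k (R.left i))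
      (coadj k H (v * R.right i))
    = ∑ i ∈ R.index, TensorProduct.map ((LinearMap.mul k H).flip (R.left i))
      (LinearMap.mulRight k (R.right i)) (coadj k H v) := by
  have h5 : ∀ (a : H) (t : H ⊗[k] H), TensorProduct.map LinearMap.id (LinearMap.mulLeft k a) t
      = (i2) a * t := by
    intro a t
    induction t with
    | zero => simp
    | add a b ha hb => rw [map_add, ha, hb, mul_add]
    | tmul p q => simp
  have h6 : ∀ (a b : H) (t : H ⊗[k] H), TensorProduct.map ((LinearMap.mul k H).flip a)
      (LinearMap.mulRight k b) t = t * (a ⊗ₜ b) := by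
    intro a b t
    induction t with
    | zero => simp
    | add a b ha hb => rw [map_add, ha, hb, add_mul]
    | tmul p q => simp
  simp only [h5, h6, coadj_mul]
  rw [← Finset.mul_sum, R.eq]
  refine Eq.trans (R.convMul_apply (toConv (i2).toLinearMap) _).symm ?_
  rw [← mul_assoc, hom_mul_S, one_mul]
  rfl

lemma adj_equiv (β : H →ₗ[k] H) (hm : ∀ a b, β (a * b) = β a * β b)
    (hc : ∀ a, comul (R := k) (β a) = TensorProduct.map β β (comul a))
    (hS : ∀ a, SS (β a) = β (SS a)) (x h : H) :
    β (adj k H x h) = adj k H (β x) (β h) := by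
  rw [adj_repr x (ℛ k h), adj_apply, hc]
  conv_rhs => rw [← (ℛ k h).eq]
  simp [hm, hS]

lemma coadj_equiv (β : H →ₗ[k] H) (hm : ∀ a b, β (a * b) = β a * β b) (h1 : β 1 = 1)
    (hc : ∀ a, comul (R := k) (β a) = TensorProduct.map β β (comul a))
    (hS : ∀ a, SS (β a) = β (SS a)) (h : H) :
    coadj k H (β h) = TensorProduct.map β β (coadj k H h) := by
  have h5 : ∀ (a : H) (t : H ⊗[k] H), TensorProduct.map β β ((1 ⊗ₜ a) * t)
      = (1 ⊗ₜ β a) * TensorProduct.map β β t := by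
    intro a t
    induction t with
    | zero => simp
    | add a b ha hb => rw [mul_add, map_add, ha, hb, map_add, mul_add]
    | tmul p q => simp [hm, h1]
  rw [coadj_repr (ℛ k h)]
  change LinearMap.mul' k (H ⊗[k] H) (TensorProduct.map _ _ (comul (β h))) = _
  rw [hc]
  conv_lhs => rw [← (ℛ k h).eq]
  simp only [map_sum, TensorProduct.map_tmul, h5]
  simp [hS, hc]

end Classical1

section Bridge

open TensorProduct Coalgebra

/-- Twisting an ordinary Yetter-Drinfel'd module. -/
lemma twist_isYD {k H V : Type} [Field k] [Ring H] [HopfAlgebra k H]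
    [AddCommGroup V] [Module k V]
    (A : Hopf k H) (βe : H ≃ₗ[k] H) (hβ : ∀ a, A.bmap a = βe a)
    (hmul : ∀ a b, A.mul a b = βe (a * b))
    (hcomul : ∀ a, A.comul a = TensorProduct.map βe.toLinearMap βe.toLinearMap (comul a))
    (hcounit : ∀ a, A.counit a = counit (R := k) a) (hone : A.one = 1)
    (hm : ∀ a b, βe (a * b) = βe a * βe b)
    (hc : ∀ a, comul (R := k) (βe a) =
      TensorProduct.map βe.toLinearMap βe.toLinearMap (comul a))
    (ζ : V ≃ₗ[k] V) (act : V →ₗ[k] H →ₗ[k] V) (r : V →ₗ[k] V ⊗[k] H)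
    (a1 : ∀ v, act v 1 = v) (a2 : ∀ v a b, act (act v a) b = act v (a * b))
    (a3 : ∀ v a, ζ (act v a) = act (ζ v) (βe a))
    (r1 : ∀ v, TensorProduct.rid k V (TensorProduct.map LinearMap.id counit (r v)) = v)
    (r2 : ∀ v, TensorProduct.map r LinearMap.id (r v) =
      (TensorProduct.assoc k V H H).symm (TensorProduct.map LinearMap.id comul (r v)))
    (r3 : ∀ v, r (ζ v) = TensorProduct.map ζ.toLinearMap βe.toLinearMap (r v))
    (yd : ∀ (v : V) (h : H) (ι : Type) (R : Repr k h ι),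
      ∑ i ∈ R.index, TensorProduct.map LinearMap.id (LinearMap.mulLeft k (R.left i))
        (r (act v (R.right i)))
      = ∑ i ∈ R.index, TensorProduct.map (act.flip (R.left i))
        (LinearMap.mulRight k (R.right i)) (r v)) :
    IsYD k A ζ.toLinearMap (act.compr₂ ζ.toLinearMap)
      (TensorProduct.map ζ.toLinearMap βe.toLinearMap ∘ₗ r) := by
  have hβ' : A.bmap = βe.toLinearMap := LinearMap.ext hβ
  have hcounit' : A.counit = counit := LinearMap.ext hcounit
  refine ⟨⟨?_, ?_, ?_⟩, ⟨?_, ?_, ?_⟩, ?_⟩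
  · intro m a b
    simp [hβ, hmul, a3, a2, hm]
  · intro m a
    simp [hβ, a3]
  · intro m
    simp [hone, a1]
  · intro m
    simp [hβ', r3]
  · intro m
    have e : ∀ t : V ⊗[k] H, TensorProduct.rid k V (TensorProduct.map LinearMap.id A.counit
        (TensorProduct.map ζ.toLinearMap βe.toLinearMap t)) =
        ζ (TensorProduct.rid k V (TensorProduct.map LinearMap.id counit t)) := by
      intro t
      induction t with
      | zero => simp
      | add a b ha hb => simp only [map_add, ha, hb]
      | tmul p q =>
        have := A.counit_bmap q
        rw [hβ, hcounit, hcounit] at this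
        simp [hcounit, this]
    exact (e _).trans (by rw [r1]; rfl)
  · intro m
    let T : (V ⊗[k] H) ⊗[k] H →ₗ[k] (V ⊗[k] H) ⊗[k] H :=
      TensorProduct.map (TensorProduct.map (ζ.toLinearMap ∘ₗ ζ.toLinearMap)
        (βe.toLinearMap ∘ₗ βe.toLinearMap)) (βe.toLinearMap ∘ₗ βe.toLinearMap)
    have e1 : ∀ t : V ⊗[k] H, TensorProduct.map
        (TensorProduct.map ζ.toLinearMap βe.toLinearMap ∘ₗ r) A.bmap
        (TensorProduct.map ζ.toLinearMap βe.toLinearMap t) =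
        T (TensorProduct.map r LinearMap.id t) := by
      intro t
      induction t with
      | zero => simp
      | add a b ha hb => simp only [map_add, ha, hb]
      | tmul p q => simp only [T, TensorProduct.map_tmul, TensorProduct.map_comp,
          LinearMap.comp_apply, hβ, r3, LinearEquiv.coe_coe, LinearMap.id_coe, id_eq]
    have e2 : ∀ t : V ⊗[k] H, (TensorProduct.assoc k V H H).symm
        (TensorProduct.map ζ.toLinearMap A.comul
          (TensorProduct.map ζ.toLinearMap βe.toLinearMap t)) =
        T ((TensorProduct.assoc k V H H).symm (TensorProduct.map LinearMap.id comul t)) := by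
      intro t
      induction t with
      | zero => simp
      | add a b ha hb => simp only [map_add, ha, hb]
      | tmul p q =>
        simp only [TensorProduct.map_tmul, LinearEquiv.coe_coe, LinearMap.id_coe, id_eq, hcomul,
          hc]
        induction comul (R := k) q with
        | zero => simp
        | add a b ha hb => simp only [map_add, TensorProduct.tmul_add, ha, hb]
        | tmul x y => simp [T]
    exact (e1 _).trans ((congrArg T (r2 m)).trans (e2 _).symm)
  · intro v h ι s h1 h2 hs
    rw [hcomul, ← hc] at hs
    have key := yd v (βe h) ι ⟨s, h1, h2, hs.symm⟩
    let T : V ⊗[k] H →ₗ[k] V ⊗[k] H :=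
      TensorProduct.map (ζ.toLinearMap ∘ₗ ζ.toLinearMap)
        (βe.toLinearMap ∘ₗ βe.toLinearMap ∘ₗ βe.toLinearMap)
    have key2 := congrArg T key
    simp only [map_sum] at key2
    refine Eq.trans (Finset.sum_congr rfl fun i _ => ?_)
      (key2.trans (Finset.sum_congr rfl fun i _ => ?_))
    · simp only [LinearMap.comp_apply, LinearMap.compr₂_apply, LinearEquiv.coe_coe, r3]
      induction r (act v (h2 i)) with
      | zero => simp
      | add a b ha hb => simp only [map_add, ha, hb]
      | tmul x y => simp [T, hβ, hmul, hm]
    · simp only [LinearMap.comp_apply]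
      induction r v with
      | zero => simp
      | add a b ha hb => simp only [map_add, ha, hb]
      | tmul x y => simp [T, hβ, hmul, hm, a3]

lemma core (k H : Type) [Field k] [Ring H] [HopfAlgebra k H]
    (A : Hopf k H) (βe : H ≃ₗ[k] H) (hβ : βe.toLinearMap = A.bmap)
    (hmul : ∀ a b, A.mul a b = βe (a * b))
    (hcomul : ∀ a, A.comul a = TensorProduct.map βe.toLinearMap βe.toLinearMap (comul a))
    (hcounit : ∀ a, A.counit a = counit (R := k) a) (hone : A.one = 1)
    (hS : ∀ a, A.S a = HopfAlgebra.antipode k a)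
    (sym : ∀ (V W : Type) (_ : AddCommGroup V) (_ : Module k V)
      (_ : AddCommGroup W) (_ : Module k W)
      (ζVe : V ≃ₗ[k] V) (ractV : V →ₗ[k] H →ₗ[k] V) (ρV : V →ₗ[k] V ⊗[k] H)
      (ζWe : W ≃ₗ[k] W) (ractW : W →ₗ[k] H →ₗ[k] W) (ρW : W →ₗ[k] W ⊗[k] H),
      IsYD k A ζVe.toLinearMap ractV ρV → IsYD k A ζWe.toLinearMap ractW ρW →
      ∀ x : V ⊗[k] W,
        braid k ractW ζWe.symm.toLinearMap ρV ζVe.symm.toLinearMap βe.symm.toLinearMap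
          (braid k ractV ζVe.symm.toLinearMap ρW ζWe.symm.toLinearMap
            βe.symm.toLinearMap x) = x) :
    ∀ x : H, x = A.counit x • A.one := by
  have hβ1 : ∀ a, A.bmap a = βe a := fun a => by rw [← hβ]; rfl
  have hm : ∀ a b, βe (a * b) = βe a * βe b := by
    intro a b
    have := A.bmap_mul a b
    simp only [hβ1, hmul] at this
    exact βe.injective this
  have hb1 : βe 1 = 1 := by
    have := A.bmap_one
    rwa [hβ1, hone] at this
  have hc : ∀ a, comul (R := k) (βe a) =
      TensorProduct.map βe.toLinearMap βe.toLinearMap (comul a) := by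
    intro a
    have := A.comul_bmap a
    rw [← hβ, LinearEquiv.coe_coe, hcomul, hcomul] at this
    exact (TensorProduct.congr βe βe).injective this
  have hSβ : ∀ a, HopfAlgebra.antipode k (βe a) = βe (HopfAlgebra.antipode k a) := by
    intro a
    have := A.S_bmap a
    simpa only [hβ1, hS] using this
  have YV := twist_isYD A βe hβ1 hmul hcomul hcounit hone hm hc βe (adj k H) comul
    adj_one adj_adj (adj_equiv βe.toLinearMap hm hc hSβ)
    (fun v => by
      have := congrArg (TensorProduct.rid k H) (Coalgebra.lTensor_counit_comul (R := k) v)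
      simp only [TensorProduct.rid_tmul, one_smul] at this
      exact this)
    (fun v => (Coalgebra.coassoc_symm_apply (R := k) v).symm) hc
    (fun v h ι R => adj_yd v h R)
  have YW := twist_isYD A βe hβ1 hmul hcomul hcounit hone hm hc βe (LinearMap.mul k H) (coadj k H)
    (fun v => by simp) (fun v a b => by simp [mul_assoc]) (fun v a => by simp [hm])
    coadj_counit coadj_coassoc (coadj_equiv βe.toLinearMap hm hb1 hc hSβ)
    (fun v h ι R => coadj_yd v h R)
  intro v
  have key := sym H H _ _ _ _ βe _ _ βe _ _ YV YW (v ⊗ₜ 1)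
  have hb1' : βe.symm 1 = 1 := by rw [LinearEquiv.symm_apply_eq, hb1]
  have s1 : braid k ((adj k H).compr₂ βe.toLinearMap) βe.symm.toLinearMap
      (TensorProduct.map βe.toLinearMap βe.toLinearMap ∘ₗ coadj k H) βe.symm.toLinearMap
      βe.symm.toLinearMap (v ⊗ₜ 1) = 1 ⊗ₜ v := by
    simp [braid, coadj_one, Algebra.TensorProduct.one_def, hb1, hb1', adj_one]
  have s2 : braid k ((LinearMap.mul k H).compr₂ βe.toLinearMap) βe.symm.toLinearMap
      (TensorProduct.map βe.toLinearMap βe.toLinearMap ∘ₗ comul) βe.symm.toLinearMap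
      βe.symm.toLinearMap (1 ⊗ₜ v) = comul v := by
    simp only [braid, LinearMap.comp_apply, TensorProduct.map_tmul]
    induction comul (R := k) v with
    | zero => simp
    | add a b ha hb => simp only [map_add, TensorProduct.tmul_add, ha, hb]
    | tmul x y => simp [hb1']
  rw [s1, s2] at key
  have := congrArg (TensorProduct.lid k H) (Coalgebra.rTensor_counit_comul (R := k) v)
  rw [key] at this
  simp only [LinearMap.rTensor_tmul, TensorProduct.lid_tmul, one_smul] at this
  rw [hcounit, hone, this]

end Bridge

section Untwist

variable {k H : Type} [Field k] [AddCommGroup H] [Module k H]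

lemma symm_mul (A : Hopf k H) (βe : H ≃ₗ[k] H) (hβ : ∀ a, A.bmap a = βe a) (a b : H) :
    βe.symm (A.mul a b) = A.mul (βe.symm a) (βe.symm b) := by
  rw [LinearEquiv.symm_apply_eq, ← hβ, A.bmap_mul, hβ, hβ]
  simp

/-- untwisted ring -/
@[reducible] def utRing (A : Hopf k H) (βe : H ≃ₗ[k] H) (hβ : ∀ a, A.bmap a = βe a) : Ring H :=
  { (inferInstance : AddCommGroup H) with
    mul := fun a b => βe.symm (A.mul a b)
    one := A.one
    left_distrib := fun a b c => by
      change βe.symm (A.mul a (b + c)) = βe.symm (A.mul a b) + βe.symm (A.mul a c)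
      simp
    right_distrib := fun a b c => by
      change βe.symm (A.mul (a + b) c) = βe.symm (A.mul a c) + βe.symm (A.mul b c)
      simp
    zero_mul := fun a => by
      change βe.symm (A.mul 0 a) = 0
      simp
    mul_zero := fun a => by
      change βe.symm (A.mul a 0) = 0
      simp
    mul_assoc := fun a b c => by
      change βe.symm (A.mul (βe.symm (A.mul a b)) c) = βe.symm (A.mul a (βe.symm (A.mul b c)))
      have := A.hom_assoc (βe.symm a) (βe.symm b) (βe.symm c)
      simp only [hβ, LinearEquiv.apply_symm_apply] at this
      rw [symm_mul A βe hβ a b, symm_mul A βe hβ b c, this]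
    one_mul := fun a => by
      change βe.symm (A.mul A.one a) = a
      rw [A.one_mul, hβ, LinearEquiv.symm_apply_apply]
    mul_one := fun a => by
      change βe.symm (A.mul a A.one) = a
      rw [A.mul_one, hβ, LinearEquiv.symm_apply_apply]
    zsmul := (inferInstance : AddCommGroup H).zsmul
    nsmul := (inferInstance : AddCommGroup H).nsmul }

/-- untwisted algebra -/
@[reducible] def utAlgebra (A : Hopf k H) (βe : H ≃ₗ[k] H) (hβ : ∀ a, A.bmap a = βe a) :
    @Algebra k H _ (utRing A βe hβ).toSemiring :=
  letI := utRing A βe hβ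
  Algebra.ofModule
    (fun r x y => by
      change βe.symm (A.mul (r • x) y) = r • βe.symm (A.mul x y)
      simp)
    (fun r x y => by
      change βe.symm (A.mul x (r • y)) = r • βe.symm (A.mul x y)
      simp)

end Untwist

section Untwist2

open TensorProduct

variable {k H : Type} [Field k] [AddCommGroup H] [Module k H]

lemma comul_symm (A : Hopf k H) (βe : H ≃ₗ[k] H) (hβ : βe.toLinearMap = A.bmap) (c : H) :
    A.comul (βe.symm c) =
      TensorProduct.map βe.symm.toLinearMap βe.symm.toLinearMap (A.comul c) := by
  have := A.comul_bmap (βe.symm c)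
  rw [← hβ] at this
  simp only [LinearEquiv.coe_coe, LinearEquiv.apply_symm_apply] at this
  rw [this]
  exact ((TensorProduct.congr βe βe).symm_apply_apply _).symm

/-- untwisted coalgebra -/
@[reducible] noncomputable def utCoalgebra (A : Hopf k H) (βe : H ≃ₗ[k] H)
    (hβ : βe.toLinearMap = A.bmap) : Coalgebra k H where
  comul := A.comul ∘ₗ βe.symm.toLinearMap
  counit := A.counit
  coassoc := by
    ext c
    have h := A.coassoc (βe.symm (βe.symm c))
    rw [comul_symm A βe hβ, ← hβ] at h
    have e1 : ∀ t : H ⊗[k] H, TensorProduct.map βe.toLinearMap A.comul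
        (TensorProduct.map βe.symm.toLinearMap βe.symm.toLinearMap t) =
        (A.comul ∘ₗ βe.symm.toLinearMap).lTensor H t := by
      intro t
      induction t with
      | zero => simp
      | add a b ha hb => simp only [map_add, ha, hb]
      | tmul p q => simp
    have e2 : ∀ t : H ⊗[k] H, TensorProduct.map A.comul βe.toLinearMap
        (TensorProduct.map βe.symm.toLinearMap βe.symm.toLinearMap t) =
        (A.comul ∘ₗ βe.symm.toLinearMap).rTensor H t := by
      intro t
      induction t with
      | zero => simp
      | add a b ha hb => simp only [map_add, ha, hb]
      | tmul p q => simp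
    rw [e1, e2] at h
    exact h.symm
  rTensor_counit_comp_comul := by
    ext c
    apply (TensorProduct.lid k H).injective
    refine (A.counit_comul (βe.symm c)).trans ?_
    rw [← hβ]; simp
  lTensor_counit_comp_comul := by
    ext c
    apply (TensorProduct.rid k H).injective
    refine (A.comul_counit (βe.symm c)).trans ?_
    rw [← hβ]; simp

/-- untwisted Hopf algebra -/
@[reducible] noncomputable def utHopf (A : Hopf k H) (βe : H ≃ₗ[k] H)
    (hβ : βe.toLinearMap = A.bmap) (hβ1 : ∀ a, A.bmap a = βe a) :
    @HopfAlgebra k H _ (utRing A βe hβ1).toSemiring :=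
  letI i1 := utRing A βe hβ1
  letI i2 : Algebra k H := utAlgebra A βe hβ1
  letI i3 : Coalgebra k H := utCoalgebra A βe hβ
  have hmul : ∀ t u : H ⊗[k] H, t * u = TensorProduct.map βe.symm.toLinearMap
      βe.symm.toLinearMap (TensorProduct.map₂ A.mul A.mul t u) := by
    intro t u
    induction t with
    | zero => simp
    | add a b ha hb => simp only [map_add, add_mul, LinearMap.add_apply, ha, hb]
    | tmul p q =>
      induction u with
      | zero => simp
      | add a b ha hb => simp only [map_add, mul_add, ha, hb]
      | tmul p' q' =>
        simp only [Algebra.TensorProduct.tmul_mul_tmul, TensorProduct.map₂_apply_tmul,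
          TensorProduct.map_tmul]
        rfl
  letI i4 : Bialgebra k H := Bialgebra.mk' k H A.counit_one
    (fun {a b} => by
      have h : A.counit (βe.symm (A.mul a b)) = A.counit a * A.counit b := by
        rw [← A.counit_mul, ← A.counit_bmap, hβ1, LinearEquiv.apply_symm_apply]
      exact h)
    (by
      have h : βe.symm A.one = A.one := by
        rw [LinearEquiv.symm_apply_eq, ← hβ1, A.bmap_one]
      change A.comul (βe.symm A.one) = A.one ⊗ₜ[k] A.one
      rw [h, A.comul_one])
    (fun {a b} => by
      change A.comul (βe.symm (βe.symm (A.mul a b))) =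
        A.comul (βe.symm a) * A.comul (βe.symm b)
      rw [hmul, ← A.comul_mul, ← symm_mul A βe hβ1, comul_symm A βe hβ])
  { antipode := A.S
    mul_antipode_rTensor_comul := by
      ext a
      have e : ∀ t : H ⊗[k] H, LinearMap.mul' k H (A.S.rTensor H t) =
          βe.symm (TensorProduct.lift A.mul (TensorProduct.map A.S LinearMap.id t)) := by
        intro t
        induction t with
        | zero => simp
        | add a b ha hb => simp only [map_add, ha, hb]
        | tmul p q => rfl
      refine (e _).trans ?_
      refine (congrArg βe.symm (A.S_mul_id (βe.symm a))).trans ?_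
      have h : βe.symm A.one = A.one := by
        rw [LinearEquiv.symm_apply_eq, ← hβ1, A.bmap_one]
      have h2 : A.counit (βe.symm a) = A.counit a := by
        rw [← A.counit_bmap, hβ1, LinearEquiv.apply_symm_apply]
      rw [map_smul, h, h2]
      rfl
    mul_antipode_lTensor_comul := by
      ext a
      have e : ∀ t : H ⊗[k] H, LinearMap.mul' k H (A.S.lTensor H t) =
          βe.symm (TensorProduct.lift A.mul (TensorProduct.map LinearMap.id A.S t)) := by
        intro t
        induction t with
        | zero => simp
        | add a b ha hb => simp only [map_add, ha, hb]
        | tmul p q => rfl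
      refine (e _).trans ?_
      refine (congrArg βe.symm (A.id_mul_S (βe.symm a))).trans ?_
      have h : βe.symm A.one = A.one := by
        rw [LinearEquiv.symm_apply_eq, ← hβ1, A.bmap_one]
      have h2 : A.counit (βe.symm a) = A.counit a := by
        rw [← A.counit_bmap, hβ1, LinearEquiv.apply_symm_apply]
      rw [map_smul, h, h2]
      rfl }

end Untwist2

/-- if the canonical braiding of the category of right-right Yetter–Drinfel'd
modules over `(H, β)` is a symmetry, then `H = k·1`. -/
theorem symmetric_yd_implies_trivial (H : Type) [AddCommGroup H] [Module k H]
    (A : Hopf k H) (βe : H ≃ₗ[k] H) (hβ : βe.toLinearMap = A.bmap)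
    (sym : ∀ (V W : Type) (_ : AddCommGroup V) (_ : Module k V)
      (_ : AddCommGroup W) (_ : Module k W)
      (ζVe : V ≃ₗ[k] V) (ractV : V →ₗ[k] H →ₗ[k] V) (ρV : V →ₗ[k] V ⊗[k] H)
      (ζWe : W ≃ₗ[k] W) (ractW : W →ₗ[k] H →ₗ[k] W) (ρW : W →ₗ[k] W ⊗[k] H),
      IsYD k A ζVe.toLinearMap ractV ρV → IsYD k A ζWe.toLinearMap ractW ρW →
      ∀ x : V ⊗[k] W,
        braid k ractW ζWe.symm.toLinearMap ρV ζVe.symm.toLinearMap βe.symm.toLinearMap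
          (braid k ractV ζVe.symm.toLinearMap ρW ζWe.symm.toLinearMap
            βe.symm.toLinearMap x) = x) :
    ∀ x : H, x = A.counit x • A.one := by
  have hβ1 : ∀ a, A.bmap a = βe a := fun a => by rw [← hβ]; rfl
  refine @core k H _ (utRing A βe hβ1) (utHopf A βe hβ hβ1) A βe hβ ?_ ?_ ?_ ?_ ?_ sym
  · intro a b
    exact (βe.apply_symm_apply _).symm
  · intro a
    change A.comul a = TensorProduct.map βe.toLinearMap βe.toLinearMap (A.comul (βe.symm a))
    rw [hβ, ← A.comul_bmap, hβ1, LinearEquiv.apply_symm_apply]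
  · intro a; rfl
  · rfl
  · intro a; rfl

end HomHopf
end

section
/- Let (H, β) be a Hom-Hopf algebra with β bijective, and (M, ζ_M) a four-angle H-Hopf module with ζ_M bijective. Define the coinvariants ^{coH}M = {m ∈ M | ρ^l(m) = 1 ⊗ ζ_M(m)}. Then ^{coH}M is closed under the adjoint-type action m' ◁ h = Sβ^{-1}(h_1)·(ζ_M^{-1}(m')·β^{-2}(h_2)), and with this action (^{coH}M, ζ_M) is a right H-module. -/
open TensorProduct

namespace HomHopf

variable (k : Type) [Field k]

variable {H : Type} [AddCommGroup H] [Module k H]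
variable {M N P V W U : Type}
  [AddCommGroup M] [Module k M] [AddCommGroup N] [Module k N]
  [AddCommGroup P] [Module k P] [AddCommGroup V] [Module k V]
  [AddCommGroup W] [Module k W] [AddCommGroup U] [Module k U]

section generic
variable {k : Type} [Field k]

/-- An untwisted Hopf algebra, as raw data. -/
structure RawHopf {C : Type} [AddCommGroup C] [Module k C]
    (mul : C →ₗ[k] C →ₗ[k] C) (one : C) (Δ : C →ₗ[k] C ⊗[k] C) (ε : C →ₗ[k] k)
    (S : C →ₗ[k] C) : Prop where
  mul_one : ∀ a, mul a one = a
  coassoc : ∀ c, TensorProduct.map LinearMap.id Δ (Δ c)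
      = TensorProduct.assoc k C C C (TensorProduct.map Δ LinearMap.id (Δ c))
  counit_comul : ∀ c,
      TensorProduct.lid k C (TensorProduct.map ε LinearMap.id (Δ c)) = c
  comul_mul : ∀ a b, Δ (mul a b) = TensorProduct.map₂ mul mul (Δ a) (Δ b)
  comul_one : Δ one = one ⊗ₜ[k] one
  S_l : ∀ h, TensorProduct.lift mul (TensorProduct.map S LinearMap.id (Δ h)) = ε h • one
  S_r : ∀ h, TensorProduct.lift mul (TensorProduct.map LinearMap.id S (Δ h)) = ε h • one

/-- convolution action -/
noncomputable def cv {C P : Type} [AddCommGroup C] [Module k C] [AddCommGroup P] [Module k P]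
    (Δ : C →ₗ[k] C ⊗[k] C) (L : C →ₗ[k] P →ₗ[k] P) (f : C →ₗ[k] C) (F : C →ₗ[k] P) :
    C →ₗ[k] P :=
  (TensorProduct.lift L).comp ((TensorProduct.map f F).comp Δ)

variable {C M P : Type} [AddCommGroup C] [Module k C] [AddCommGroup M] [Module k M]
  [AddCommGroup P] [Module k P]
  {mul : C →ₗ[k] C →ₗ[k] C} {one : C} {Δ : C →ₗ[k] C ⊗[k] C} {ε : C →ₗ[k] k}
  {S : C →ₗ[k] C}

lemma cv_cv (hH : RawHopf mul one Δ ε S) (L : C →ₗ[k] P →ₗ[k] P)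
    (hL : ∀ a b p, L a (L b p) = L (mul a b) p) (f g : C →ₗ[k] C) (F : C →ₗ[k] P) (h : C) :
    cv Δ L f (cv Δ L g F) h =
      TensorProduct.lift L (TensorProduct.map
        ((TensorProduct.lift mul).comp ((TensorProduct.map f g).comp Δ)) F (Δ h)) := by
  have h1 : ∀ t : C ⊗[k] C, TensorProduct.lift L (TensorProduct.map f (cv Δ L g F) t)
      = TensorProduct.lift L (TensorProduct.map f ((TensorProduct.lift L).comp
          (TensorProduct.map g F)) (TensorProduct.map LinearMap.id Δ t)) := by
    intro t
    induction t with
    | zero => simp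
    | add x y hx hy => simp only [map_add, hx, hy]
    | tmul x y => simp [cv]
  have h2 : ∀ (y : C) (s : C ⊗[k] C), TensorProduct.lift L (TensorProduct.map f
        ((TensorProduct.lift L).comp (TensorProduct.map g F))
          (TensorProduct.assoc k C C C (s ⊗ₜ y)))
      = L (TensorProduct.lift mul (TensorProduct.map f g s)) (F y) := by
    intro y s
    induction s with
    | zero => simp
    | add x y hx hy => simp only [map_add, hx, hy, TensorProduct.add_tmul, LinearMap.add_apply]
    | tmul x y => simp [hL]
  have h3 : ∀ t : C ⊗[k] C, TensorProduct.lift L (TensorProduct.map f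
        ((TensorProduct.lift L).comp (TensorProduct.map g F))
          (TensorProduct.assoc k C C C (TensorProduct.map Δ LinearMap.id t)))
      = TensorProduct.lift L (TensorProduct.map
        ((TensorProduct.lift mul).comp ((TensorProduct.map f g).comp Δ)) F t) := by
    intro t
    induction t with
    | zero => simp
    | add x y hx hy => simp only [map_add, hx, hy]
    | tmul x y =>
      rw [TensorProduct.map_tmul, LinearMap.id_apply, h2]
      simp
  change TensorProduct.lift L (TensorProduct.map f (cv Δ L g F) (Δ h)) = _
  rw [h1, hH.coassoc, h3]

lemma cv_eps (hH : RawHopf mul one Δ ε S) (L : C →ₗ[k] P →ₗ[k] P)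
    (hone : ∀ p, L one p = p) (e : C →ₗ[k] C) (he : ∀ c, e c = ε c • one)
    (F : C →ₗ[k] P) (h : C) :
    TensorProduct.lift L (TensorProduct.map e F (Δ h)) = F h := by
  have h1 : ∀ t : C ⊗[k] C, TensorProduct.lift L (TensorProduct.map e F t)
      = F (TensorProduct.lid k C (TensorProduct.map ε LinearMap.id t)) := by
    intro t
    induction t with
    | zero => simp
    | add x y hx hy => simp only [map_add, hx, hy]
    | tmul x y => simp [he, hone]
  rw [h1, hH.counit_comul]

lemma cv_id_S (hH : RawHopf mul one Δ ε S) (L : C →ₗ[k] P →ₗ[k] P)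
    (hL : ∀ a b p, L a (L b p) = L (mul a b) p) (hone : ∀ p, L one p = p)
    (F : C →ₗ[k] P) : cv Δ L LinearMap.id (cv Δ L S F) = F := by
  ext h
  rw [cv_cv hH L hL, cv_eps hH L hone]
  exact hH.S_r

lemma cv_S_id (hH : RawHopf mul one Δ ε S) (L : C →ₗ[k] P →ₗ[k] P)
    (hL : ∀ a b p, L a (L b p) = L (mul a b) p) (hone : ∀ p, L one p = p)
    (F : C →ₗ[k] P) : cv Δ L S (cv Δ L LinearMap.id F) = F := by
  ext h
  rw [cv_cv hH L hL, cv_eps hH L hone]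
  exact hH.S_l

lemma cv_cancel (hH : RawHopf mul one Δ ε S) (L : C →ₗ[k] P →ₗ[k] P)
    (hL : ∀ a b p, L a (L b p) = L (mul a b) p) (hone : ∀ p, L one p = p)
    {F G : C →ₗ[k] P} (h : cv Δ L LinearMap.id F = cv Δ L LinearMap.id G) : F = G := by
  rw [← cv_S_id hH L hL hone F, h, cv_S_id hH L hL hone G]

variable {L : C →ₗ[k] M →ₗ[k] M} {R : M →ₗ[k] C →ₗ[k] M} {ρ : M →ₗ[k] C ⊗[k] M}

/-- adjoint action is one-unital -/
lemma ad_one (hH : RawHopf mul one Δ ε S)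
    (hone : ∀ p, L one p = p) (Rone : ∀ p, R p one = p) (hε : ε one = 1)
    (m : M) : cv Δ L S (R m) one = m := by
  have : S one = one := by
    have := hH.S_l one
    simpa [hH.comul_one, hH.mul_one, hε] using this
  simp [cv, hH.comul_one, this, hone, Rone]

lemma ad_coinv (hH : RawHopf mul one Δ ε S)
    (hassoc : ∀ a b c, mul a (mul b c) = mul (mul a b) c)
    (hone1 : ∀ a, mul one a = a)
    (hL : ∀ a b p, L a (L b p) = L (mul a b) p) (hone : ∀ p, L one p = p)
    (hρL : ∀ h m, ρ (L h m) = TensorProduct.map₂ mul L (Δ h) (ρ m))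
    (hρR : ∀ m h, ρ (R m h) = TensorProduct.map₂ mul R (ρ m) (Δ h))
    (m : M) (hm : ρ m = one ⊗ₜ[k] m) (h : C) :
    ρ (cv Δ L S (R m) h) = one ⊗ₜ[k] (cv Δ L S (R m) h) := by
  set n := cv Δ L S (R m) with hn
  have key : cv Δ L LinearMap.id n = R m := cv_id_S hH L hL hone _
  let L2 : C →ₗ[k] (C ⊗[k] M) →ₗ[k] (C ⊗[k] M) := (TensorProduct.map₂ mul L).comp Δ
  have e0 : ∀ s t, ∀ p : C ⊗[k] M, TensorProduct.map₂ mul L s (TensorProduct.map₂ mul L t p)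
      = TensorProduct.map₂ mul L (TensorProduct.map₂ mul mul s t) p := by
    intro s t p
    induction s with
    | zero => simp
    | add x y hx hy => simp only [map_add, LinearMap.add_apply, hx, hy]
    | tmul a b =>
      induction t with
      | zero => simp
      | add x y hx hy => simp only [map_add, LinearMap.add_apply, hx, hy]
      | tmul c d =>
        induction p with
        | zero => simp
        | add x y hx hy => simp only [map_add, hx, hy]
        | tmul u v => simp [hassoc, hL]
  have hL2 : ∀ a b p, L2 a (L2 b p) = L2 (mul a b) p := by
    intro a b p
    simp only [L2, LinearMap.comp_apply, hH.comul_mul, e0]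
  have hone2 : ∀ p, L2 one p = p := by
    intro p
    simp only [L2, LinearMap.comp_apply, hH.comul_one]
    induction p with
    | zero => simp
    | add x y hx hy => simp only [map_add, hx, hy]
    | tmul u v => simp [hone, hone1]
  have goal : ρ.comp n = (TensorProduct.mk k C M one).comp n := by
    apply cv_cancel hH L2 hL2 hone2
    ext c
    have l1 : ∀ t : C ⊗[k] C, TensorProduct.lift L2 (TensorProduct.map LinearMap.id (ρ.comp n) t)
        = ρ (TensorProduct.lift L (TensorProduct.map LinearMap.id n t)) := by
      intro t
      induction t with
      | zero => simp
      | add x y hx hy => simp only [map_add, hx, hy]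
      | tmul u v => simp [L2, hρL]
    have l2 : ∀ t : C ⊗[k] C, TensorProduct.map₂ mul R (one ⊗ₜ[k] m) t
        = TensorProduct.map LinearMap.id (R m) t := by
      intro t
      induction t with
      | zero => simp
      | add x y hx hy => simp only [map_add, hx, hy]
      | tmul u v => simp [hone1]
    have r0 : ∀ (y : C) (s : C ⊗[k] C), TensorProduct.map₂ mul L s (one ⊗ₜ[k] n y)
        = TensorProduct.map LinearMap.id ((TensorProduct.lift L).comp
            (TensorProduct.map LinearMap.id n)) (TensorProduct.assoc k C C C (s ⊗ₜ y)) := by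
      intro y s
      induction s with
      | zero => simp
      | add x y hx hy => simp only [map_add, hx, hy, TensorProduct.add_tmul, LinearMap.add_apply]
      | tmul u v => simp [hH.mul_one]
    have r1 : ∀ t : C ⊗[k] C, TensorProduct.lift L2 (TensorProduct.map LinearMap.id
          ((TensorProduct.mk k C M one).comp n) t)
        = TensorProduct.map LinearMap.id ((TensorProduct.lift L).comp
            (TensorProduct.map LinearMap.id n))
          (TensorProduct.assoc k C C C (TensorProduct.map Δ LinearMap.id t)) := by
      intro t
      induction t with
      | zero => simp
      | add x y hx hy => simp only [map_add, hx, hy]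
      | tmul u v =>
        rw [TensorProduct.map_tmul, TensorProduct.map_tmul, LinearMap.id_apply,
          LinearMap.id_apply, ← r0]
        simp [L2]
    have r2 : ∀ t : C ⊗[k] C, TensorProduct.map LinearMap.id ((TensorProduct.lift L).comp
            (TensorProduct.map LinearMap.id n)) (TensorProduct.map LinearMap.id Δ t)
        = TensorProduct.map LinearMap.id (cv Δ L LinearMap.id n) t := by
      intro t
      induction t with
      | zero => simp
      | add x y hx hy => simp only [map_add, hx, hy]
      | tmul u v => simp [cv]
    change TensorProduct.lift L2 (TensorProduct.map LinearMap.id (ρ.comp n) (Δ c))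
      = TensorProduct.lift L2 (TensorProduct.map LinearMap.id
          ((TensorProduct.mk k C M one).comp n) (Δ c))
    rw [l1, r1, ← hH.coassoc, r2, key]
    change ρ (cv Δ L LinearMap.id n c) = _
    rw [key, hρR, hm, l2]
  exact LinearMap.congr_fun goal h

lemma ad_assoc (hH : RawHopf mul one Δ ε S)
    (hL : ∀ a b p, L a (L b p) = L (mul a b) p) (hone : ∀ p, L one p = p)
    (hR : ∀ p a b, R (R p a) b = R p (mul a b))
    (hLR : ∀ a p b, L a (R p b) = R (L a p) b)
    (m : M) (a b : C) :
    cv Δ L S (R (cv Δ L S (R m) a)) b = cv Δ L S (R m) (mul a b) := by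
  have key : ∀ m, cv Δ L LinearMap.id (cv Δ L S (R m)) = R m :=
    fun m => cv_id_S hH L hL hone _
  set n := cv Δ L S (R m) with hn
  let T : (C →ₗ[k] M) →ₗ[k] (C →ₗ[k] M) :=
    { toFun := fun F => cv Δ L LinearMap.id F
      map_add' := by intro F G; ext; simp [cv, TensorProduct.map_add_right]
      map_smul' := by intro F G; ext; simp [cv, TensorProduct.map_smul_right] }
  let ad : M →ₗ[k] C →ₗ[k] M :=
    { toFun := fun m => cv Δ L S (R m)
      map_add' := by intro F G; ext; simp [cv, TensorProduct.map_add_right]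
      map_smul' := by intro F G; ext; simp [cv, TensorProduct.map_smul_right] }
  let LH : C →ₗ[k] (C →ₗ[k] M) →ₗ[k] (C →ₗ[k] M) :=
    (LinearMap.llcomp k C M M).comp L
  let F : C →ₗ[k] C →ₗ[k] M := ad.comp n
  let G : C →ₗ[k] C →ₗ[k] M := mul.compr₂ n
  have step : T.comp F = T.comp G := by
    apply cv_cancel hH LH
    · intro a b p; ext x; simp [LH, hL]
    · intro p; ext x; simp [LH, hone]
    ext c x
    have hF : T.comp F = R.comp n := by
      ext1 c
      exact key (n c)
    have f1 : ∀ t : C ⊗[k] C, TensorProduct.lift LH (TensorProduct.map LinearMap.id (R.comp n) t) x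
        = R (TensorProduct.lift L (TensorProduct.map LinearMap.id n t)) x := by
      intro t
      induction t with
      | zero => simp
      | add x y hx hy => simp only [map_add, LinearMap.add_apply, hx, hy]
      | tmul u v => simp [LH, hLR]
    have g0 : ∀ (u v : C) s, L u (TensorProduct.lift L (TensorProduct.map LinearMap.id (G v) s))
        = TensorProduct.lift L (TensorProduct.map LinearMap.id n
            (TensorProduct.map₂ mul mul (u ⊗ₜ v) s)) := by
      intro u v s
      induction s with
      | zero => simp
      | add x y hx hy => simp only [map_add, hx, hy]
      | tmul u v => simp [G, hL]
    have g1 : ∀ t : C ⊗[k] C, TensorProduct.lift LH (TensorProduct.map LinearMap.id (T.comp G) t) x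
        = TensorProduct.lift L (TensorProduct.map LinearMap.id n
            (TensorProduct.map₂ mul mul t (Δ x))) := by
      intro t
      induction t with
      | zero => simp
      | add x y hx hy => simp only [map_add, LinearMap.add_apply, hx, hy]
      | tmul u v =>
        rw [← g0]
        simp [LH, T, cv]
    change TensorProduct.lift LH (TensorProduct.map LinearMap.id (T.comp F) (Δ c)) x
      = TensorProduct.lift LH (TensorProduct.map LinearMap.id (T.comp G) (Δ c)) x
    rw [hF, f1, g1, ← hH.comul_mul]
    change R (cv Δ L LinearMap.id n c) x = cv Δ L LinearMap.id n (mul c x)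
    rw [key, hR]
  have h2 : F a = G a := cv_cancel hH L hL hone (LinearMap.congr_fun step a)
  exact LinearMap.congr_fun h2 b

end generic

/-- the coinvariants `^{coH}M` of a four-angle Hopf module are closed under the
adjoint-type action `m' ◁ h = Sβ⁻¹(h_1)·(ζ_M⁻¹(m')·β⁻²(h_2))`, which makes them a right
H-module. -/
theorem coinvariants_module (H : Type) [AddCommGroup H] [Module k H]
    (A : Hopf k H) (βe : H ≃ₗ[k] H) (hβ : βe.toLinearMap = A.bmap)
    (M : Type) [AddCommGroup M] [Module k M]
    (ζMe : M ≃ₗ[k] M)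
    (lactM : H →ₗ[k] M →ₗ[k] M) (ractM : M →ₗ[k] H →ₗ[k] M)
    (ρlM : M →ₗ[k] H ⊗[k] M) (ρrM : M →ₗ[k] M ⊗[k] H)
    (hM : IsFourAngle k A ζMe.toLinearMap lactM ractM ρlM ρrM) :
    ∀ Tco : Submodule k M,
      Tco = LinearMap.ker (ρlM - (TensorProduct.mk k H M A.one).comp ζMe.toLinearMap) →
    ∀ adAct : M →ₗ[k] H →ₗ[k] M,
      adAct = TensorProduct.curry
        ((TensorProduct.lift lactM).comp
          ((TensorProduct.map (A.S.comp βe.symm.toLinearMap)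
              (TensorProduct.lift ((ractM.comp ζMe.symm.toLinearMap).compl₂
                (βe.symm.toLinearMap.comp βe.symm.toLinearMap)))).comp
            ((TensorProduct.leftComm k M H H).toLinearMap.comp
              (TensorProduct.map LinearMap.id A.comul)))) →
    (∀ m ∈ Tco, ζMe.toLinearMap m ∈ Tco) ∧
    (∀ m ∈ Tco, ∀ h : H, adAct m h ∈ Tco) ∧
    (∀ m ∈ Tco, ∀ a b : H,
        adAct (adAct m a) (A.bmap b) = adAct (ζMe.toLinearMap m) (A.mul a b)) ∧
    (∀ m ∈ Tco, ∀ a : H,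
        ζMe.toLinearMap (adAct m a) = adAct (ζMe.toLinearMap m) (A.bmap a)) ∧
    (∀ m ∈ Tco, adAct m A.one = ζMe.toLinearMap m) := by
  intro Tco hT adAct hAd
  have bs : ∀ x, A.bmap (βe.symm x) = x := fun x => by rw [← hβ]; simp
  have sb : ∀ x, βe.symm (A.bmap x) = x := fun x => by rw [← hβ]; simp
  have s_mul : ∀ a b, βe.symm (A.mul a b) = A.mul (βe.symm a) (βe.symm b) := fun a b => by
    apply βe.injective
    change βe.toLinearMap _ = βe.toLinearMap _
    rw [hβ, bs, A.bmap_mul, bs, bs]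
  have s_one : βe.symm A.one = A.one := by rw [← A.bmap_one, sb, A.bmap_one]
  have s_S : ∀ a, A.S (βe.symm a) = βe.symm (A.S a) := fun a => by
    conv_rhs => rw [← bs a, A.S_bmap, sb]
  have s_eps : ∀ a, A.counit (βe.symm a) = A.counit a := fun a => by
    conv_rhs => rw [← bs a, A.counit_bmap]
  let βi : H →ₗ[k] H := βe.symm.toLinearMap
  let ζi : M →ₗ[k] M := ζMe.symm.toLinearMap
  have mm : ∀ t : H ⊗[k] H, TensorProduct.map βi βi (TensorProduct.map A.bmap A.bmap t) = t := by
    intro t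
    induction t with
    | zero => simp
    | add x y hx hy => simp only [map_add, hx, hy]
    | tmul u v => simp [βi, sb]
  have mm' : ∀ t : H ⊗[k] H, TensorProduct.map A.bmap A.bmap (TensorProduct.map βi βi t) = t := by
    intro t
    induction t with
    | zero => simp
    | add x y hx hy => simp only [map_add, hx, hy]
    | tmul u v => simp [βi, bs]
  have s_comul : ∀ a, A.comul (βe.symm a) = TensorProduct.map βi βi (A.comul a) := fun a => by
    conv_rhs => rw [← bs a, A.comul_bmap, mm]
  have zl : ∀ a m, ζMe.symm (lactM a m) = lactM (βe.symm a) (ζMe.symm m) := fun a m => by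
    apply ζMe.injective
    have := hM.lmod.zeta_act (βe.symm a) (ζMe.symm m)
    simp only [LinearEquiv.coe_coe, LinearEquiv.apply_symm_apply, bs] at this ⊢
    exact this.symm
  have zr : ∀ m a, ζMe.symm (ractM m a) = ractM (ζMe.symm m) (βe.symm a) := fun m a => by
    apply ζMe.injective
    have := hM.rmod.zeta_act (ζMe.symm m) (βe.symm a)
    simp only [LinearEquiv.coe_coe, LinearEquiv.apply_symm_apply, bs] at this ⊢
    exact this.symm
  have mz : ∀ t : H ⊗[k] M, TensorProduct.map βi ζi
      (TensorProduct.map A.bmap ζMe.toLinearMap t) = t := by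
    intro t
    induction t with
    | zero => simp
    | add x y hx hy => simp only [map_add, hx, hy]
    | tmul u v => simp [βi, ζi, sb]
  have mz' : ∀ t : H ⊗[k] M, TensorProduct.map A.bmap ζMe.toLinearMap
      (TensorProduct.map βi ζi t) = t := by
    intro t
    induction t with
    | zero => simp
    | add x y hx hy => simp only [map_add, hx, hy]
    | tmul u v => simp [βi, ζi, bs]
  have s_ρ : ∀ m, ρlM (ζMe.symm m) = TensorProduct.map βi ζi (ρlM m) := fun m => by
    have := hM.lcom.coact_zeta (ζMe.symm m)
    simp only [LinearEquiv.coe_coe, LinearEquiv.apply_symm_apply] at this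
    rw [this, mz]
  let mul' : H →ₗ[k] H →ₗ[k] H := A.mul.compr₂ βi
  let Δ' : H →ₗ[k] H ⊗[k] H := (TensorProduct.map βi βi).comp A.comul
  let L' : H →ₗ[k] M →ₗ[k] M := lactM.compr₂ ζi
  let R' : M →ₗ[k] H →ₗ[k] M := ractM.compr₂ ζi
  let ρ' : M →ₗ[k] H ⊗[k] M := (TensorProduct.map βi ζi).comp ρlM
  have hassoc : ∀ a b c, mul' a (mul' b c) = mul' (mul' a b) c := by
    intro a b c
    have := A.hom_assoc a b c
    have h2 := congrArg (fun x => βe.symm (βe.symm x)) this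
    simpa [mul', βi, s_mul, sb] using h2
  have hone1 : ∀ a, mul' A.one a = a := by
    intro a
    simp [mul', βi, A.one_mul, sb]
  have hH : RawHopf mul' A.one Δ' A.counit A.S := by
    constructor
    · intro a
      simp [mul', βi, A.mul_one, sb]
    · intro c
      have mc : ∀ t : H ⊗[k] H, TensorProduct.map (βi.comp βi) (βi.comp βi) t
          = TensorProduct.map βi βi (TensorProduct.map βi βi t) := by
        intro t
        rw [TensorProduct.map_comp, LinearMap.comp_apply]
      have h1 : ∀ t : H ⊗[k] H, TensorProduct.map LinearMap.id Δ' (TensorProduct.map βi βi t)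
          = TensorProduct.map (βi.comp βi) (TensorProduct.map (βi.comp βi) (βi.comp βi))
            (TensorProduct.map A.bmap A.comul t) := by
        intro t
        induction t with
        | zero => simp
        | add x y hx hy => simp only [map_add, hx, hy]
        | tmul u v =>
          rw [TensorProduct.map_tmul, TensorProduct.map_tmul, TensorProduct.map_tmul,
            TensorProduct.map_tmul, mc]
          simp [βi, Δ', sb, s_comul]
      have h2 : ∀ t : H ⊗[k] H, TensorProduct.map Δ' LinearMap.id (TensorProduct.map βi βi t)
          = TensorProduct.map (TensorProduct.map (βi.comp βi) (βi.comp βi)) (βi.comp βi)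
            (TensorProduct.map A.comul A.bmap t) := by
        intro t
        induction t with
        | zero => simp
        | add x y hx hy => simp only [map_add, hx, hy]
        | tmul u v =>
          rw [TensorProduct.map_tmul, TensorProduct.map_tmul, TensorProduct.map_tmul,
            TensorProduct.map_tmul, mc]
          simp [βi, Δ', sb, s_comul]
      change TensorProduct.map LinearMap.id Δ' (TensorProduct.map βi βi (A.comul c)) =
        TensorProduct.assoc k H H H (TensorProduct.map Δ' LinearMap.id
          (TensorProduct.map βi βi (A.comul c)))
      rw [h1, h2, A.coassoc, TensorProduct.map_map_assoc]
    · intro c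
      have h1 : ∀ t : H ⊗[k] H, TensorProduct.lid k H (TensorProduct.map A.counit LinearMap.id
            (TensorProduct.map βi βi t))
          = βi (TensorProduct.lid k H (TensorProduct.map A.counit LinearMap.id t)) := by
        intro t
        induction t with
        | zero => simp
        | add x y hx hy => simp only [map_add, hx, hy]
        | tmul u v => simp [βi, s_eps]
      change TensorProduct.lid k H (TensorProduct.map A.counit LinearMap.id
            (TensorProduct.map βi βi (A.comul c))) = c
      rw [h1, A.counit_comul]
      exact sb c
    · intro a b
      have h1 : ∀ s t : H ⊗[k] H, TensorProduct.map βi βi (TensorProduct.map βi βi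
            (TensorProduct.map₂ A.mul A.mul s t))
          = TensorProduct.map₂ mul' mul' (TensorProduct.map βi βi s)
            (TensorProduct.map βi βi t) := by
        intro s t
        induction s with
        | zero => simp
        | add x y hx hy => simp only [map_add, LinearMap.add_apply, hx, hy]
        | tmul u v =>
          induction t with
          | zero => simp
          | add x y hx hy => simp only [map_add, hx, hy]
          | tmul x y => simp [βi, mul', s_mul]
      change TensorProduct.map βi βi (A.comul (βe.symm (A.mul a b))) =
        TensorProduct.map₂ mul' mul' (TensorProduct.map βi βi (A.comul a))
          (TensorProduct.map βi βi (A.comul b))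
      rw [s_comul, A.comul_mul, h1]
    · simp [Δ', βi, A.comul_one, s_one]
    · intro h
      have h1 : ∀ t : H ⊗[k] H, TensorProduct.lift mul' (TensorProduct.map A.S LinearMap.id
            (TensorProduct.map βi βi t))
          = βi (βi (TensorProduct.lift A.mul (TensorProduct.map A.S LinearMap.id t))) := by
        intro t
        induction t with
        | zero => simp
        | add x y hx hy => simp only [map_add, hx, hy]
        | tmul u v => simp [βi, mul', s_S, s_mul]
      change TensorProduct.lift mul' (TensorProduct.map A.S LinearMap.id
            (TensorProduct.map βi βi (A.comul h))) = _
      rw [h1, A.S_mul_id]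
      simp [βi, s_one]
    · intro h
      have h1 : ∀ t : H ⊗[k] H, TensorProduct.lift mul' (TensorProduct.map LinearMap.id A.S
            (TensorProduct.map βi βi t))
          = βi (βi (TensorProduct.lift A.mul (TensorProduct.map LinearMap.id A.S t))) := by
        intro t
        induction t with
        | zero => simp
        | add x y hx hy => simp only [map_add, hx, hy]
        | tmul u v => simp [βi, mul', s_S, s_mul]
      change TensorProduct.lift mul' (TensorProduct.map LinearMap.id A.S
            (TensorProduct.map βi βi (A.comul h))) = _
      rw [h1, A.id_mul_S]
      simp [βi, s_one]
  have hL : ∀ a b p, L' a (L' b p) = L' (mul' a b) p := by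
    intro a b p
    have := hM.lmod.assoc a b p
    have h2 := congrArg (fun x => ζMe.symm (ζMe.symm x)) this
    simpa [L', mul', βi, ζi, zl, s_mul, sb] using h2
  have hone : ∀ p, L' A.one p = p := by
    intro p
    have := hM.lmod.one_act p
    simp [L', ζi, this]
  have hR : ∀ p a b, R' (R' p a) b = R' p (mul' a b) := by
    intro p a b
    have := hM.rmod.assoc p a b
    have h2 := congrArg (fun x => ζMe.symm (ζMe.symm x)) this
    simpa [R', mul', βi, ζi, zr, s_mul, sb] using h2
  have Rone : ∀ p, R' p A.one = p := by
    intro p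
    have := hM.rmod.act_one p
    simp [R', ζi, this]
  have hLR : ∀ a p b, L' a (R' p b) = R' (L' a p) b := by
    intro a p b
    have := hM.bimod a p b
    have h2 := congrArg (fun x => ζMe.symm (ζMe.symm x)) this
    simpa [L', R', βi, ζi, zr, zl, sb] using h2
  have hρL : ∀ h m, ρ' (L' h m) = TensorProduct.map₂ mul' L' (Δ' h) (ρ' m) := by
    intro h m
    have h1 : ∀ (s : H ⊗[k] H) (t : H ⊗[k] M), TensorProduct.map βi ζi (TensorProduct.map βi ζi
            (TensorProduct.map₂ A.mul lactM s t))
          = TensorProduct.map₂ mul' L' (TensorProduct.map βi βi s)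
            (TensorProduct.map βi ζi t) := by
      intro s t
      induction s with
      | zero => simp
      | add x y hx hy => simp only [map_add, LinearMap.add_apply, hx, hy]
      | tmul u v =>
        induction t with
        | zero => simp
        | add x y hx hy => simp only [map_add, hx, hy]
        | tmul x y => simp [βi, ζi, mul', L', s_mul, zl]
    change TensorProduct.map βi ζi (ρlM (ζMe.symm (lactM h m))) =
        TensorProduct.map₂ mul' L' (TensorProduct.map βi βi (A.comul h))
          (TensorProduct.map βi ζi (ρlM m))
    rw [s_ρ, hM.cll, h1]
  have hρR : ∀ m h, ρ' (R' m h) = TensorProduct.map₂ mul' R' (ρ' m) (Δ' h) := by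
    intro m h
    have h1 : ∀ (t : H ⊗[k] M) (s : H ⊗[k] H), TensorProduct.map βi ζi (TensorProduct.map βi ζi
            (TensorProduct.map₂ A.mul ractM t s))
          = TensorProduct.map₂ mul' R' (TensorProduct.map βi ζi t)
            (TensorProduct.map βi βi s) := by
      intro t s
      induction s with
      | zero => simp
      | add x y hx hy => simp only [map_add, hx, hy]
      | tmul u v =>
        induction t with
        | zero => simp
        | add x y hx hy => simp only [map_add, LinearMap.add_apply, hx, hy]
        | tmul x y => simp [βi, ζi, mul', R', s_mul, zr]
    change TensorProduct.map βi ζi (ρlM (ζMe.symm (ractM m h))) =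
        TensorProduct.map₂ mul' R' (TensorProduct.map βi ζi (ρlM m))
          (TensorProduct.map βi βi (A.comul h))
    rw [s_ρ, hM.crl, h1]
  have had : ∀ m h, adAct m h = ζMe (cv Δ' L' A.S (R' m) h) := by
    intro m h
    have h1 : ∀ t : H ⊗[k] H, (TensorProduct.lift lactM)
          ((TensorProduct.map (A.S.comp βe.symm.toLinearMap)
              (TensorProduct.lift ((ractM.comp ζMe.symm.toLinearMap).compl₂
                (βe.symm.toLinearMap.comp βe.symm.toLinearMap))))
            ((TensorProduct.leftComm k M H H) (m ⊗ₜ t)))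
        = ζMe (TensorProduct.lift L' (TensorProduct.map A.S (R' m)
            (TensorProduct.map βi βi t))) := by
      intro t
      induction t with
      | zero => simp
      | add x y hx hy => simp only [map_add, TensorProduct.tmul_add, hx, hy]
      | tmul u v => simp [L', R', βi, ζi, zr]
    rw [hAd]
    exact h1 (A.comul h)
  have equi : ∀ m a, ζMe (cv Δ' L' A.S (R' m) a) = cv Δ' L' A.S (R' (ζMe m)) (A.bmap a) := by
    intro m a
    have h1 : ∀ t : H ⊗[k] H, ζMe (TensorProduct.lift L' (TensorProduct.map A.S (R' m)
            (TensorProduct.map βi βi t)))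
        = TensorProduct.lift L' (TensorProduct.map A.S (R' (ζMe m)) t) := by
      intro t
      induction t with
      | zero => simp
      | add x y hx hy => simp only [map_add, hx, hy]
      | tmul u v =>
        apply ζMe.symm.injective
        simp [L', R', βi, ζi, zr, zl, s_S]
    change ζMe (TensorProduct.lift L' (TensorProduct.map A.S (R' m)
            (TensorProduct.map βi βi (A.comul a)))) =
      TensorProduct.lift L' (TensorProduct.map A.S (R' (ζMe m))
        (TensorProduct.map βi βi (A.comul (A.bmap a))))
    rw [h1, A.comul_bmap, mm]
  have memT : ∀ m, m ∈ Tco ↔ ρlM m = A.one ⊗ₜ[k] ζMe m := by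
    intro m
    rw [hT, LinearMap.mem_ker, LinearMap.sub_apply, sub_eq_zero]
    rfl
  have memT' : ∀ m, m ∈ Tco ↔ ρ' m = A.one ⊗ₜ[k] m := by
    intro m
    rw [memT]
    constructor
    · intro h
      change TensorProduct.map βi ζi (ρlM m) = _
      rw [h]
      simp [βi, ζi, s_one]
    · intro h
      rw [← mz' (ρlM m)]
      change TensorProduct.map A.bmap ζMe.toLinearMap (ρ' m) = _
      rw [h]
      simp [A.bmap_one]
  have hζ : ∀ m ∈ Tco, ζMe m ∈ Tco := by
    intro m hm
    rw [memT] at hm ⊢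
    have := hM.lcom.coact_zeta m
    rw [hm] at this
    simpa [A.bmap_one] using this
  refine ⟨hζ, ?_, ?_, ?_, ?_⟩
  · intro m hm h
    rw [had]
    apply hζ
    rw [memT'] at hm ⊢
    exact ad_coinv hH hassoc hone1 hL hone hρL hρR m hm h
  · intro m _ a b
    rw [had, had, ← equi, ad_assoc hH hL hone hR hLR, equi, had]
    simp [mul', βi, bs]
  · intro m _ a
    rw [had, had]
    exact congrArg ζMe (equi m a)
  · intro m _
    rw [had, ad_one hH hone Rone A.counit_one]
    rfl

end HomHopf
end
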